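/- Let F_1 and F_2 be k-uniform hypergraphs satisfying the hypotheses of the 0-statement theorem (F_2 has at least three edges, m_k(F_1) ≥ m_k(F_2) ≥ 1 > 0, F_1 and F_2 strictly k-balanced, F_1 strictly balanced with respect to m_k(·, F_2), and F*(F_1,F_2) asymmetric-balanced). Then there exist constants c > 0 and L > 0, depending only on F_1 and F_2, such that if p ≤ c·n^{-1/m_k(F_1,F_2)} then with probability tending to 1 as n → ∞ every minimal closed (F_1,F_2)-core of H^k(n,p) has at most L vertices. -/

import Mathlib

open scoped Classical

namespace ARR

/-- The vertex support of a hypergraph given by its edge set. -/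
def vset (G : Finset (Finset ℕ)) : Finset ℕ := G.sup id

/-- Number of vertices of a hypergraph. -/
def vcount (G : Finset (Finset ℕ)) : ℕ := (vset G).card

/-- `G` is a `k`-uniform hypergraph. -/
def IsUniform (k : ℕ) (G : Finset (Finset ℕ)) : Prop := ∀ e ∈ G, e.card = k

/-- The `k`-density `d_k`. -/
noncomputable def dk (k : ℕ) (G : Finset (Finset ℕ)) : ℝ :=
  if G.card = 0 then 0
  else if G.card = 1 ∧ vcount G = k then 1 / (k : ℝ)
  else ((G.card : ℝ) - 1) / ((vcount G : ℝ) - (k : ℝ))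

/-- The `k`-density `m_k`: the maximum of `d_k` over subgraphs. -/
noncomputable def mk (k : ℕ) (G : Finset (Finset ℕ)) : ℝ :=
  sSup {x : ℝ | ∃ H ⊆ G, x = dk k H}

/-- The usual density `m(G)`. -/
noncomputable def mDens (G : Finset (Finset ℕ)) : ℝ :=
  sSup {x : ℝ | ∃ H ⊆ G, 1 ≤ vcount H ∧ x = (H.card : ℝ) / (vcount H : ℝ)}

/-- `G` is strictly `k`-balanced: every proper subgraph has strictly smaller `k`-density. -/
def StrictlyKBalanced (k : ℕ) (G : Finset (Finset ℕ)) : Prop :=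
  ∀ H ⊆ G, H ≠ G → dk k H < dk k G

/-- The asymmetric `k`-density `m_k(F₁,F₂)`. -/
noncomputable def mkA (k : ℕ) (F1 F2 : Finset (Finset ℕ)) : ℝ :=
  sSup {x : ℝ | ∃ H ⊆ F1, H.Nonempty ∧
    x = (H.card : ℝ) / ((vcount H : ℝ) - (k : ℝ) + 1 / mk k F2)}

/-- `F₁` is strictly balanced with respect to `m_k(·, F₂)`. -/
def StrictlyBalancedWrt (k : ℕ) (F1 F2 : Finset (Finset ℕ)) : Prop :=
  ∀ H ⊆ F1, H.Nonempty → H ≠ F1 →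
    (H.card : ℝ) / ((vcount H : ℝ) - (k : ℝ) + 1 / mk k F2) < mkA k F1 F2

/-- `F'` is a copy of `F` (an isomorphic image of `F`). -/
def IsCopy (F F' : Finset (Finset ℕ)) : Prop :=
  ∃ f : ℕ → ℕ, Set.InjOn f ↑(vset F) ∧ F' = F.image (Finset.image f)

/-- `G` contains a copy of `F`. -/
def ContainsCopy (G F : Finset (Finset ℕ)) : Prop := ∃ F' ⊆ G, IsCopy F F'

/-- Asymmetric Ramsey arrow `G → (F₁, …, F_r)`. -/
def Arrow {r : ℕ} (G : Finset (Finset ℕ)) (F : Fin r → Finset (Finset ℕ)) : Prop :=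
  ∀ χ : Finset ℕ → Fin r, ∃ i : Fin r, ∃ F' ⊆ G, IsCopy (F i) F' ∧ ∀ e ∈ F', χ e = i

/-- Symmetric Ramsey arrow `G → (F)_r`. -/
def ArrowSym (G F : Finset (Finset ℕ)) (r : ℕ) : Prop :=
  ∀ χ : Finset ℕ → Fin r, ∃ i : Fin r, ∃ F' ⊆ G, IsCopy F F' ∧ ∀ e ∈ F', χ e = i

/-- Two-colour asymmetric arrow `G → (F₁, F₂)`. -/
def Arrow2 (G F1 F2 : Finset (Finset ℕ)) : Prop :=
  ∀ χ : Finset ℕ → Fin 2,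
    (∃ F' ⊆ G, IsCopy F1 F' ∧ ∀ e ∈ F', χ e = 0) ∨
    (∃ F' ⊆ G, IsCopy F2 F' ∧ ∀ e ∈ F', χ e = 1)

/-- The edge set of the complete `k`-uniform hypergraph on `{0, …, n-1}`. -/
def allEdges (k n : ℕ) : Finset (Finset ℕ) := (Finset.range n).powersetCard k

/-- Probability that the binomial random hypergraph `H^k(n,p)` satisfies property `P`. -/
noncomputable def prob (k n : ℕ) (p : ℝ) (P : Finset (Finset ℕ) → Prop) : ℝ :=
  ∑ G ∈ (allEdges k n).powerset,
    if P G then p ^ G.card * (1 - p) ^ ((allEdges k n).card - G.card) else 0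

/-- Expected number of members of a family `𝓕` which appear as subgraphs of `H^k(n,p)`. -/
noncomputable def expectCount (k n : ℕ) (p : ℝ) (𝓕 : Finset (Finset (Finset ℕ))) : ℝ :=
  ∑ G ∈ (allEdges k n).powerset,
    (p ^ G.card * (1 - p) ^ ((allEdges k n).card - G.card)) *
      ((𝓕.filter (fun F => F ⊆ G)).card : ℝ)

/-- `K₃^{+k}`: the triangle on `{0,1,2}` with the `k-2` vertices `{3,…,k}` added to each edge. -/
def K3plus (k : ℕ) : Finset (Finset ℕ) :=
  {({0, 1} : Finset ℕ) ∪ (Finset.range (k + 1)).filter (fun x => 3 ≤ x),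
   ({0, 2} : Finset ℕ) ∪ (Finset.range (k + 1)).filter (fun x => 3 ≤ x),
   ({1, 2} : Finset ℕ) ∪ (Finset.range (k + 1)).filter (fun x => 3 ≤ x)}

/-- The `i`-th edge `{i, i+1, …, i+k-1}` (mod `t`) of the tight cycle on `t` vertices. -/
def cycEdge (k t i : ℕ) : Finset ℕ := (Finset.range k).image (fun j => (i + j) % t)

/-- The tight cycle `C_t` (k-uniform) on vertex set `{0, …, t-1}`. -/
def tightCycle (k t : ℕ) : Finset (Finset ℕ) := (Finset.range t).image (cycEdge k t)

/-- The tight path `T^k_ℓ` on vertex set `{0, …, ℓ-1}`. -/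
def tightPath (k l : ℕ) : Finset (Finset ℕ) :=
  (Finset.range (l - k + 1)).image (fun i => (Finset.range k).image (fun j => i + j))

/-- The cycle length `t_k`: `t₄ = 8`, `t₅ = 14`, and `t_k = k²` for `k ≥ 6`. -/
def tk (k : ℕ) : ℕ := if k = 4 then 8 else if k = 5 then 14 else k ^ 2

/-- Shift all vertices of a hypergraph by `a` (used to form vertex-disjoint unions). -/
def shiftHG (a : ℕ) (G : Finset (Finset ℕ)) : Finset (Finset ℕ) :=
  G.image (Finset.image (· + a))

/-- A set of edges is `m`-intersecting if any two distinct edges meet in at most `m` vertices. -/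
def IntersectingLE (m : ℕ) (S : Finset (Finset ℕ)) : Prop :=
  ∀ e ∈ S, ∀ f ∈ S, e ≠ f → (e ∩ f).card ≤ m

/-- `e₀` is an attachment edge of `Fst` as a member of the family `F*(F₁,F₂)`. -/
def IsAttachment (F1 F2 Fst : Finset (Finset ℕ)) (e0 : Finset ℕ) : Prop :=
  ∃ F2' : Finset (Finset ℕ), e0 ∈ F2' ∧ IsCopy F2 F2' ∧
    ∃ g : Finset ℕ → Finset (Finset ℕ),
      (∀ e ∈ F2'.erase e0, IsCopy F1 (g e) ∧ e ∈ g e) ∧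
      Fst = F2' ∪ (F2'.erase e0).biUnion g

/-- `Fst` is a member of the family `F*(F₁,F₂)`. -/
def IsFStar (F1 F2 Fst : Finset (Finset ℕ)) : Prop := ∃ e0, IsAttachment F1 F2 Fst e0

/-- `Fst` is a generic member of `F*(F₁,F₂)`. -/
def IsGeneric (F1 F2 Fst : Finset (Finset ℕ)) : Prop :=
  ∃ F2' : Finset (Finset ℕ), ∃ e0 ∈ F2', IsCopy F2 F2' ∧
    ∃ g : Finset ℕ → Finset (Finset ℕ),
      (∀ e ∈ F2'.erase e0, IsCopy F1 (g e) ∧ e ∈ g e) ∧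
      Fst = F2' ∪ (F2'.erase e0).biUnion g ∧
      (∀ e ∈ F2'.erase e0, vset (g e) ∩ vset F2' = e) ∧
      (∀ e ∈ F2'.erase e0, ∀ e' ∈ F2'.erase e0, e ≠ e' →
        (vset (g e) \ e) ∩ (vset (g e') \ e') = ∅)

/-- The family `F*(F₁,F₂)` is asymmetric-balanced. -/
def AsymBalanced (k : ℕ) (F1 F2 : Finset (Finset ℕ)) : Prop :=
  ∀ Fst, IsFStar F1 F2 Fst →
    ∀ H ⊆ Fst, vset H ⊂ vset Fst → (∃ e0 ∈ H, IsAttachment F1 F2 Fst e0) →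
      mkA k F1 F2 ≤ ((Fst.card : ℝ) - (H.card : ℝ)) / ((vcount Fst : ℝ) - (vcount H : ℝ)) ∧
      (((Fst.card : ℝ) - (H.card : ℝ)) / ((vcount Fst : ℝ) - (vcount H : ℝ)) = mkA k F1 F2 →
        (∃ e0, IsAttachment F1 F2 Fst e0 ∧ H = {e0}) ∧ IsGeneric F1 F2 Fst)

/-- An edge `e` of `G` is closed (w.r.t. `F₁`, `F₂`): it lies in a copy of `F₁` and a copy
of `F₂` inside `G` whose edge sets intersect exactly in `{e}`. -/
def ClosedEdge (F1 F2 G : Finset (Finset ℕ)) (e : Finset ℕ) : Prop :=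
  ∃ A ⊆ G, ∃ B ⊆ G, IsCopy F1 A ∧ IsCopy F2 B ∧ A ∩ B = {e}

/-- Every edge of `G` is closed within `G`. -/
def SelfClosed (F1 F2 G : Finset (Finset ℕ)) : Prop := ∀ e ∈ G, ClosedEdge F1 F2 G e

/-- `Ĥ`: the subgraph of `H` obtained by repeatedly deleting open edges; equivalently the
largest subgraph of `H` all of whose edges are closed within it. -/
noncomputable def hatH (F1 F2 H : Finset (Finset ℕ)) : Finset (Finset ℕ) :=
  (H.powerset.filter (fun G => SelfClosed F1 F2 G)).sup id

/-- `G'` is an `(F₁,F₂)`-core of `Ĥ`. -/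
def IsCore (F1 F2 H G' : Finset (Finset ℕ)) : Prop :=
  G' ⊆ hatH F1 F2 H ∧
    ∀ A ⊆ hatH F1 F2 H, (IsCopy F1 A ∨ IsCopy F2 A) → (A ⊆ G' ∨ A ∩ G' = ∅)

/-- `G'` is a minimal (nonempty) closed `(F₁,F₂)`-core of `Ĥ`. -/
def IsMinimalCore (F1 F2 H G' : Finset (Finset ℕ)) : Prop :=
  G'.Nonempty ∧ IsCore F1 F2 H G' ∧
    ∀ G'' ⊆ G', G''.Nonempty → G'' ≠ G' → ¬ IsCore F1 F2 H G''


theorem mem_vset {G : Finset (Finset ℕ)} {x : ℕ} : x ∈ vset G ↔ ∃ e ∈ G, x ∈ e := by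
  simp [vset, Finset.mem_sup]

theorem sub_vset {G : Finset (Finset ℕ)} {e : Finset ℕ} (h : e ∈ G) : e ⊆ vset G :=
  fun _ hx => mem_vset.2 ⟨e, h, hx⟩

theorem vset_mono {G H : Finset (Finset ℕ)} (h : G ⊆ H) : vset G ⊆ vset H := by
  intro x hx
  obtain ⟨e, he, hx⟩ := mem_vset.1 hx
  exact mem_vset.2 ⟨e, h he, hx⟩

theorem vset_union (G H : Finset (Finset ℕ)) : vset (G ∪ H) = vset G ∪ vset H := by
  ext x
  simp only [mem_vset, Finset.mem_union]
  grind

theorem vset_single (e : Finset ℕ) : vset {e} = e := by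
  simp [vset]

theorem vset_image (F : Finset (Finset ℕ)) (f : ℕ → ℕ) :
    vset (F.image (Finset.image f)) = (vset F).image f := by
  ext x
  simp only [mem_vset, Finset.mem_image]
  constructor
  · rintro ⟨e, ⟨a, ha, rfl⟩, hx⟩
    obtain ⟨y, hy, rfl⟩ := Finset.mem_image.1 hx
    exact ⟨y, ⟨a, ha, hy⟩, rfl⟩
  · rintro ⟨y, ⟨a, ha, hy⟩, rfl⟩
    exact ⟨_, ⟨a, ha, rfl⟩, Finset.mem_image_of_mem f hy⟩

theorem image_injOn {F : Finset (Finset ℕ)} {f : ℕ → ℕ} (hf : Set.InjOn f ↑(vset F)) :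
    Set.InjOn (Finset.image f) (F : Set (Finset ℕ)) := by
  intro a ha b hb hab
  have ha' := sub_vset (Finset.mem_coe.1 ha)
  have hb' := sub_vset (Finset.mem_coe.1 hb)
  have key : ∀ a b : Finset ℕ, a ⊆ vset F → b ⊆ vset F → a.image f = b.image f → a ⊆ b := by
    intro a b ha hb hab x hx
    have : f x ∈ b.image f := hab ▸ Finset.mem_image_of_mem f hx
    obtain ⟨y, hy, hyx⟩ := Finset.mem_image.1 this
    have := hf (hb hy) (ha hx) hyx
    exact this ▸ hy
  exact Finset.Subset.antisymm (key a b ha' hb' hab) (key b a hb' ha' hab.symm)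

theorem copy_card {F F' : Finset (Finset ℕ)} (h : IsCopy F F') : F'.card = F.card := by
  obtain ⟨f, hf, rfl⟩ := h
  exact Finset.card_image_of_injOn (image_injOn hf)

theorem copy_vcount {F F' : Finset (Finset ℕ)} (h : IsCopy F F') : vcount F' = vcount F := by
  obtain ⟨f, hf, rfl⟩ := h
  rw [vcount, vset_image, Finset.card_image_of_injOn hf, vcount]

theorem copy_uniform {k : ℕ} {F F' : Finset (Finset ℕ)} (h : IsCopy F F') (hu : IsUniform k F) :
    IsUniform k F' := by
  obtain ⟨f, hf, rfl⟩ := h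
  intro e he
  obtain ⟨a, ha, rfl⟩ := Finset.mem_image.1 he
  rw [Finset.card_image_of_injOn (hf.mono (by exact_mod_cast sub_vset ha)), hu a ha]

theorem copy_sub {F F' H : Finset (Finset ℕ)} (h : IsCopy F F') (hH : H ⊆ F') :
    ∃ H0 ⊆ F, H0.card = H.card ∧ vcount H0 = vcount H := by
  obtain ⟨f, hf, rfl⟩ := h
  refine ⟨F.filter (fun e => e.image f ∈ H), Finset.filter_subset _ _, ?_⟩
  have hc : IsCopy (F.filter (fun e => e.image f ∈ H)) H := by
    refine ⟨f, hf.mono ?_, ?_⟩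
    · exact_mod_cast vset_mono (Finset.filter_subset _ _)
    · ext e
      simp only [Finset.mem_image, Finset.mem_filter]
      constructor
      · intro he
        obtain ⟨a, ha, rfl⟩ := Finset.mem_image.1 (hH he)
        exact ⟨a, ⟨ha, he⟩, rfl⟩
      · rintro ⟨a, ⟨_, h⟩, rfl⟩
        exact h
  exact ⟨(copy_card hc).symm, (copy_vcount hc).symm⟩

theorem uniform_sub {k : ℕ} {G H : Finset (Finset ℕ)} (hu : IsUniform k G) (h : H ⊆ G) :
    IsUniform k H := fun e he => hu e (h he)

theorem vcount_ge {k : ℕ} {G : Finset (Finset ℕ)} (hu : IsUniform k G) (h : G.Nonempty) :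
    k ≤ vcount G := by
  obtain ⟨e, he⟩ := h
  rw [← hu e he]
  exact Finset.card_le_card (sub_vset he)

theorem vcount_gt {k : ℕ} {G : Finset (Finset ℕ)} (hu : IsUniform k G) (h : 2 ≤ G.card) :
    k < vcount G := by
  obtain ⟨e, he, f, hf, hef⟩ := Finset.one_lt_card.1 h
  rcases (vcount_ge hu ⟨e, he⟩).lt_or_eq with h' | h'
  · exact h'
  · exfalso
    have h1 := Finset.eq_of_subset_of_card_le (sub_vset he) (by
      change vcount G ≤ _; rw [hu e he, h'])
    have h2 := Finset.eq_of_subset_of_card_le (sub_vset hf) (by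
      change vcount G ≤ _; rw [hu f hf, h'])
    exact hef (h1.trans h2.symm)

/-- `sSup` of a finite family indexed by subsets attained strictly at the top. -/
theorem sup_sub_attained {F : Finset (Finset ℕ)} (φ : Finset (Finset ℕ) → ℝ)
    (P : Finset (Finset ℕ) → Prop) (hP : P F)
    (hb : ∀ H ⊆ F, P H → H ≠ F → φ H < φ F) :
    sSup {x : ℝ | ∃ H ⊆ F, P H ∧ x = φ H} = φ F := by
  apply IsGreatest.csSup_eq
  refine ⟨⟨F, subset_rfl, hP, rfl⟩, ?_⟩
  rintro x ⟨H, hH, hPH, rfl⟩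
  by_cases h : H = F
  · rw [h]
  · exact (hb H hH hPH h).le

theorem mk_eq {k : ℕ} {F : Finset (Finset ℕ)} (h : StrictlyKBalanced k F) : mk k F = dk k F := by
  have := sup_sub_attained (F := F) (dk k) (fun _ => True) trivial (fun H hH _ hne => h H hH hne)
  simpa [mk] using this

theorem mkA_eq {k : ℕ} {F1 F2 : Finset (Finset ℕ)} (hne : F1.Nonempty)
    (h : StrictlyBalancedWrt k F1 F2) :
    mkA k F1 F2 = (F1.card : ℝ) / ((vcount F1 : ℝ) - (k : ℝ) + 1 / mk k F2) := by
  have hmem : mkA k F1 F2 ∈ {x : ℝ | ∃ H ⊆ F1, H.Nonempty ∧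
      x = (H.card : ℝ) / ((vcount H : ℝ) - (k : ℝ) + 1 / mk k F2)} := by
    apply Set.Nonempty.csSup_mem
    · exact ⟨_, F1, subset_rfl, hne, rfl⟩
    · apply Set.Finite.subset (Finset.finite_toSet (F1.powerset.image
        (fun H => (H.card : ℝ) / ((vcount H : ℝ) - (k : ℝ) + 1 / mk k F2))))
      rintro x ⟨H, hH, _, rfl⟩
      simp only [Finset.coe_image, Set.mem_image, Finset.mem_coe, Finset.mem_powerset]
      exact ⟨H, hH, rfl⟩
  obtain ⟨H, hH, hn, he⟩ := hmem
  by_cases hc : H = F1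
  · rw [he, hc]
  · exact absurd he (ne_of_gt (h H hH hn hc))

theorem dk_big {k : ℕ} {G : Finset (Finset ℕ)} (h : 2 ≤ G.card) :
    dk k G = ((G.card : ℝ) - 1) / ((vcount G : ℝ) - (k : ℝ)) := by
  rw [dk, if_neg (by omega), if_neg (by omega)]

theorem dk_congr {k : ℕ} {G H : Finset (Finset ℕ)} (h : G.card = H.card)
    (h' : vcount G = vcount H) : dk k G = dk k H := by
  rw [dk, dk, h, h']

/-- density of a copy -/
theorem dens_eq {k : ℕ} {F B : Finset (Finset ℕ)} (hu : IsUniform k F)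
    (hb : StrictlyKBalanced k F) (h2 : 2 ≤ F.card) (hB : IsCopy F B) :
    (B.card : ℝ) - 1 = mk k F * ((vcount B : ℝ) - k) := by
  rw [copy_card hB, copy_vcount hB, mk_eq hb, dk_big h2]
  have : (k : ℝ) < vcount F := by exact_mod_cast vcount_gt hu h2
  have : (vcount F : ℝ) - k ≠ 0 := by linarith
  field_simp

theorem dens_lt {k : ℕ} {F B H : Finset (Finset ℕ)} (hu : IsUniform k F)
    (hb : StrictlyKBalanced k F) (hB : IsCopy F B) (hH : H ⊆ B)
    (hne : H ≠ B) (hc : 2 ≤ H.card) :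
    (H.card : ℝ) - 1 < mk k F * ((vcount H : ℝ) - k) := by
  obtain ⟨H0, hH0, h1, h2⟩ := copy_sub hB hH
  have hlt : H.card < B.card := Finset.card_lt_card (hH.ssubset_of_ne hne)
  have hne0 : H0 ≠ F := by
    rintro rfl
    rw [copy_card hB] at hlt
    omega
  have := hb H0 hH0 hne0
  rw [← mk_eq hb, dk_big (by omega), h1, h2] at this
  have hv : (k : ℝ) < vcount H := by
    exact_mod_cast vcount_gt (uniform_sub (copy_uniform hB hu) hH) hc
  rwa [div_lt_iff₀ (by linarith)] at this

theorem dens_le {k : ℕ} {F B H : Finset (Finset ℕ)} (hu : IsUniform k F)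
    (hb : StrictlyKBalanced k F) (h2 : 2 ≤ F.card) (hB : IsCopy F B) (hH : H ⊆ B)
    (hn : H.Nonempty) :
    (H.card : ℝ) - 1 ≤ mk k F * ((vcount H : ℝ) - k) := by
  by_cases hc : 2 ≤ H.card
  · by_cases he : H = B
    · rw [he]; exact (dens_eq hu hb h2 hB).le
    · exact (dens_lt hu hb hB hH he hc).le
  · have : H.card = 1 := by have := hn.card_pos; omega
    obtain ⟨e, rfl⟩ := Finset.card_eq_one.1 this
    have : vcount {e} = k := by
      rw [vcount, vset_single]; exact copy_uniform hB hu e (hH (by simp))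
    rw [this]; simp


theorem split_v {B B1 B2 : Finset (Finset ℕ)} (hU : B1 ∪ B2 = B) :
    (vcount B1 : ℝ) + vcount B2 = vcount B + ((vset B1 ∩ vset B2).card : ℝ) := by
  have := Finset.card_union_add_card_inter (vset B1) (vset B2)
  rw [← vset_union, hU] at this
  simp only [vcount]
  exact_mod_cast this.symm

theorem split_small {k : ℕ} {F B B1 B2 : Finset (Finset ℕ)} (hu : IsUniform k F)
    (hb : StrictlyKBalanced k F) (h2 : 2 ≤ F.card) (hm : 1 ≤ mk k F) (hB : IsCopy F B)
    (hU : B1 ∪ B2 = B) (hd : Disjoint B1 B2) (hn1 : B1.Nonempty) (hn2 : B2.Nonempty)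
    (hI : (vset B1 ∩ vset B2).card < k) : F.card = 2 := by
  by_contra h
  have hv := split_v hU
  have hc : B1.card + B2.card = B.card := by rw [← hU, Finset.card_union_of_disjoint hd]
  have hc' : (B1.card : ℝ) + B2.card = B.card := by exact_mod_cast hc
  have hBF := copy_card hB
  have s1 : B1 ⊆ B := hU ▸ Finset.subset_union_left
  have s2 : B2 ⊆ B := hU ▸ Finset.subset_union_right
  have p1 := hn1.card_pos
  have p2 := hn2.card_pos
  have n1 : B1 ≠ B := by rintro rfl; omega
  have n2 : B2 ≠ B := by rintro rfl; omega
  have e0 := dens_eq hu hb h2 hB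
  have l1 := dens_le hu hb h2 hB s1 hn1
  have l2 := dens_le hu hb h2 hB s2 hn2
  have hI' : ((vset B1 ∩ vset B2).card : ℝ) + 1 ≤ k := by exact_mod_cast hI
  have key : (B.card : ℝ) - 2 < mk k F * ((vcount B1 : ℝ) + vcount B2 - 2 * k) := by
    by_cases hb1 : 2 ≤ B1.card
    · have := dens_lt hu hb hB s1 n1 hb1
      linarith
    · have := dens_lt hu hb hB s2 n2 (by omega)
      linarith
  rw [hv] at key
  nlinarith

theorem split_edge {k : ℕ} {F B B1 B2 : Finset (Finset ℕ)} {e : Finset ℕ} (hu : IsUniform k F)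
    (hb : StrictlyKBalanced k F) (h2 : 2 ≤ F.card) (_hm : 1 ≤ mk k F) (hB : IsCopy F B)
    (hU : B1 ∪ B2 = B) (hd : Disjoint B1 B2) (hn1 : 2 ≤ B1.card) (hn2 : B2.Nonempty)
    (he : e ∈ B1) (hI : vset B1 ∩ vset B2 = e) : False := by
  have hv := split_v hU
  have hc : B1.card + B2.card = B.card := by rw [← hU, Finset.card_union_of_disjoint hd]
  have hc' : (B1.card : ℝ) + B2.card = B.card := by exact_mod_cast hc
  have s1 : B1 ⊆ B := hU ▸ Finset.subset_union_left
  have s2 : B2 ⊆ B := hU ▸ Finset.subset_union_right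
  have p2 := hn2.card_pos
  have n1 : B1 ≠ B := by rintro rfl; omega
  have he2 : e ∉ B2 := Finset.disjoint_left.1 hd he
  have hcard : (insert e B2).card = B2.card + 1 := Finset.card_insert_of_notMem he2
  have n2 : insert e B2 ≠ B := by intro h; rw [h] at hcard; omega
  have hvs : vset (insert e B2) = vset B2 := by
    rw [Finset.insert_eq, vset_union, vset_single]
    apply Finset.union_eq_right.2
    rw [← hI]; exact Finset.inter_subset_right
  have e0 := dens_eq hu hb h2 hB
  have l1 := dens_lt hu hb hB s1 n1 hn1
  have l2 := dens_lt hu hb hB (Finset.insert_subset (s1 he) s2) n2 (by omega)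
  rw [hcard, vcount, hvs] at l2
  have hk : ((vset B1 ∩ vset B2).card : ℝ) = k := by
    rw [hI, copy_uniform hB hu e (s1 he)]
  rw [hk] at hv
  push_cast at l2
  simp only [vcount] at *
  have : mk k F * (((vset B1).card : ℝ) - k) + mk k F * (((vset B2).card : ℝ) - k)
      = mk k F * (((vset B).card : ℝ) - k) := by
    rw [← mul_add]; congr 1; linarith
  linarith

/-- `(A,e)` is a pendant copy of `F1` in `G`. -/
def Pend (F1 G A : Finset (Finset ℕ)) (e : Finset ℕ) : Prop :=
  IsCopy F1 A ∧ A ⊆ G ∧ e ∈ A ∧ ∀ f ∈ G, f ∉ A → Disjoint f (vset A \ e)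

theorem pend_inter {F1 G A B : Finset (Finset ℕ)} {e : Finset ℕ} (h : Pend F1 G A e)
    (hB : B ⊆ G) : vset (B ∩ A) ∩ vset (B \ A) ⊆ e := by
  intro x hx
  rw [Finset.mem_inter] at hx
  obtain ⟨h1, h2⟩ := hx
  obtain ⟨f, hf, hxf⟩ := mem_vset.1 h2
  rw [Finset.mem_sdiff] at hf
  have hd := h.2.2.2 f (hB hf.1) hf.2
  by_contra hxe
  have : x ∈ vset A := vset_mono Finset.inter_subset_right h1
  exact Finset.disjoint_left.1 hd hxf (Finset.mem_sdiff.2 ⟨this, hxe⟩)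

theorem no_pend {k : ℕ} {F1 F2 G A : Finset (Finset ℕ)} {e : Finset ℕ}
    (hu1 : IsUniform k F1) (hu2 : IsUniform k F2) (h2 : 2 ≤ F1.card)
    (h3 : 3 ≤ F2.card) (hm1 : 1 ≤ mk k F1) (hm2 : 1 ≤ mk k F2)
    (hb1 : StrictlyKBalanced k F1) (hb2 : StrictlyKBalanced k F2)
    (hG : SelfClosed F1 F2 G) (hP : Pend F1 G A e) : False := by
  have hP' := hP
  obtain ⟨hA, hAG, heA, -⟩ := hP'
  have hAc := copy_card hA
  have hAu := copy_uniform hA hu1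
  obtain ⟨f, hfA, hfe⟩ : ∃ f ∈ A, f ≠ e := by
    have : 1 < A.card := by omega
    exact Finset.exists_mem_ne this e
  obtain ⟨A', hA'G, B, hBG, hA', hB, hAB⟩ := hG f (hAG hfA)
  have hff : f ∈ A' ∩ B := by rw [hAB]; simp
  rw [Finset.mem_inter] at hff
  obtain ⟨hfA', hfB⟩ := hff
  have hek : e.card = k := hAu e heA
  -- step 1
  have step1 : A' = A ∨ F1.card = 2 := by
    by_contra hcon
    push Not at hcon
    obtain ⟨hne, hc2⟩ := hcon
    have hU : (A' ∩ A) ∪ (A' \ A) = A' := by ext x; simp; tauto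
    have hd : Disjoint (A' ∩ A) (A' \ A) := by
      rw [Finset.disjoint_left]; intro x; simp; tauto
    have hn1 : (A' ∩ A).Nonempty := ⟨f, Finset.mem_inter.2 ⟨hfA', hfA⟩⟩
    have hn2 : (A' \ A).Nonempty := by
      rw [Finset.sdiff_nonempty]
      intro hs
      exact hne (Finset.eq_of_subset_of_card_le hs (by rw [copy_card hA', hAc]))
    have hI := pend_inter hP hA'G
    have hIe : vset (A' ∩ A) ∩ vset (A' \ A) = e := by
      apply Finset.eq_of_subset_of_card_le hI
      rw [hek]
      by_contra hlt
      exact hc2 (split_small hu1 hb1 h2 hm1 hA' hU hd hn1 hn2 (by omega))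
    by_cases he : e ∈ A'
    · refine split_edge hu1 hb1 h2 hm1 hA' hU hd ?_ hn2 (Finset.mem_inter.2 ⟨he, heA⟩) hIe
      exact Finset.one_lt_card.2 ⟨e, Finset.mem_inter.2 ⟨he, heA⟩, f,
        Finset.mem_inter.2 ⟨hfA', hfA⟩, hfe.symm⟩
    · have hvs : vset (insert e (A' ∩ A)) = vset (A' ∩ A) := by
        rw [Finset.insert_eq, vset_union, vset_single]
        apply Finset.union_eq_right.2
        rw [← hIe]; exact Finset.inter_subset_left
      have hcard : (insert e (A' ∩ A)).card = (A' ∩ A).card + 1 :=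
        Finset.card_insert_of_notMem (by simp [he])
      have l1 := dens_le hu1 hb1 h2 hA (H := insert e (A' ∩ A))
        (Finset.insert_subset heA Finset.inter_subset_right) (by simp)
      rw [hcard, vcount, hvs] at l1
      have l2 := dens_le hu1 hb1 h2 hA' (H := A' \ A) Finset.sdiff_subset hn2
      have e0 := dens_eq hu1 hb1 h2 hA'
      have hv := split_v hU
      rw [hIe, hek] at hv
      have hc' : ((A' ∩ A).card : ℝ) + (A' \ A).card = A'.card := by
        have := Finset.card_union_of_disjoint hd
        rw [hU] at this
        exact_mod_cast this.symm
      have hcard2 : (A' \ A).card = 1 := by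
        have := hn2.card_pos
        by_contra hx
        have hne' : A' \ A ≠ A' := by
          intro h
          have : f ∈ A' \ A := by rw [h]; exact hfA'
          simp [hfA] at this
        have l3 := dens_lt hu1 hb1 hA' (H := A' \ A) Finset.sdiff_subset hne' (by omega)
        have : mk k F1 * (((vset (A' ∩ A)).card : ℝ) - k) + mk k F1 * ((vcount (A' \ A) : ℝ) - k)
            = mk k F1 * ((vcount A' : ℝ) - k) := by
          rw [← mul_add]; congr 1; simp only [vcount] at *; linarith
        push_cast at l1
        linarith
      obtain ⟨e', he'⟩ := Finset.card_eq_one.1 hcard2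
      have he'm : e' ∈ A' \ A := by rw [he']; simp
      rw [Finset.mem_sdiff] at he'm
      have hsub : e ⊆ e' := by
        have : e ⊆ vset (A' \ A) := by rw [← hIe]; exact Finset.inter_subset_right
        rwa [he', vset_single] at this
      have := Finset.eq_of_subset_of_card_le hsub (by
        rw [hek, copy_uniform hA' hu1 e' he'm.1])
      exact he'm.2 (this ▸ heA)
  have hBc := copy_card hB
  have hU : (B ∩ A) ∪ (B \ A) = B := by ext x; simp; tauto
  have hd : Disjoint (B ∩ A) (B \ A) := by
    rw [Finset.disjoint_left]; intro x; simp; tauto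
  have hn1 : (B ∩ A).Nonempty := ⟨f, Finset.mem_inter.2 ⟨hfB, hfA⟩⟩
  have hn2 : (B \ A).Nonempty := by
    rw [Finset.sdiff_nonempty]
    intro hs
    rcases step1 with rfl | hc
    · rw [Finset.inter_eq_right.2 hs] at hAB
      rw [hAB] at hBc
      simp at hBc
      omega
    · have := Finset.card_le_card hs
      omega
  have hI := pend_inter hP hBG
  have hIe : vset (B ∩ A) ∩ vset (B \ A) = e := by
    apply Finset.eq_of_subset_of_card_le hI
    rw [hek]
    by_contra hlt
    have := (split_small hu2 hb2 (by omega) hm2 hB hU hd hn1 hn2 (by omega))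
    omega
  by_cases he : e ∈ B
  · refine split_edge hu2 hb2 (by omega) hm2 hB hU hd ?_ hn2 (Finset.mem_inter.2 ⟨he, heA⟩) hIe
    exact Finset.one_lt_card.2 ⟨e, Finset.mem_inter.2 ⟨he, heA⟩, f,
        Finset.mem_inter.2 ⟨hfB, hfA⟩, hfe.symm⟩
  · have hB1 : B ∩ A = {f} := by
      rcases step1 with rfl | hc
      · rw [Finset.inter_comm]; exact hAB
      · have hs : B ∩ A ⊆ A.erase e := by
          intro x hx
          rw [Finset.mem_inter] at hx
          exact Finset.mem_erase.2 ⟨fun h => he (h ▸ hx.1), hx.2⟩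
        have h1 := Finset.card_le_card hs
        rw [Finset.card_erase_of_mem heA] at h1
        symm
        apply Finset.eq_of_subset_of_card_le
        · simp [hfA, hfB]
        · simp; omega
    have hsub : e ⊆ f := by
      have : e ⊆ vset (B ∩ A) := by rw [← hIe]; exact Finset.inter_subset_left
      rwa [hB1, vset_single] at this
    exact hfe (Finset.eq_of_subset_of_card_le hsub (by rw [hek, hAu f hfA])).symm


theorem hatH_sub (F1 F2 H : Finset (Finset ℕ)) : hatH F1 F2 H ⊆ H := by
  intro e he
  simp only [hatH, Finset.mem_sup, Finset.mem_filter, Finset.mem_powerset, id] at he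
  obtain ⟨G, hG, he⟩ := he
  exact hG.1 he

theorem hatH_closed (F1 F2 H : Finset (Finset ℕ)) : SelfClosed F1 F2 (hatH F1 F2 H) := by
  intro e he
  have he' := he
  simp only [hatH, Finset.mem_sup, Finset.mem_filter, Finset.mem_powerset, id] at he'
  obtain ⟨G, hG, heG⟩ := he'
  have hs : G ⊆ hatH F1 F2 H := by
    intro x hx
    simp only [hatH, Finset.mem_sup, Finset.mem_filter, Finset.mem_powerset, id]
    exact ⟨G, hG, hx⟩
  obtain ⟨A, hA, B, hB, h⟩ := hG.2 e heG
  exact ⟨A, hA.trans hs, B, hB.trans hs, h⟩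

theorem core_absorb {F1 F2 H G' A : Finset (Finset ℕ)} {e : Finset ℕ} (h : IsCore F1 F2 H G')
    (hA : A ⊆ hatH F1 F2 H) (hc : IsCopy F1 A ∨ IsCopy F2 A) (heA : e ∈ A) (heG : e ∈ G') :
    A ⊆ G' := by
  rcases h.2 A hA hc with h | h
  · exact h
  · exact absurd (Finset.mem_inter.2 ⟨heA, heG⟩) (by rw [h]; simp)

theorem core_closed {F1 F2 H G' : Finset (Finset ℕ)} (h : IsCore F1 F2 H G') :
    SelfClosed F1 F2 G' := by
  intro e he
  obtain ⟨A, hA, B, hB, hcA, hcB, hAB⟩ := hatH_closed F1 F2 H e (h.1 he)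
  have hm : e ∈ A ∩ B := by rw [hAB]; simp
  rw [Finset.mem_inter] at hm
  exact ⟨A, core_absorb h hA (Or.inl hcA) hm.1 he, B, core_absorb h hB (Or.inr hcB) hm.2 he,
    hcA, hcB, hAB⟩

theorem vset_star {B X : Finset (Finset ℕ)} {e0 : Finset ℕ}
    {g : Finset ℕ → Finset (Finset ℕ)}
    (hX : X = B ∪ (B.erase e0).biUnion g) :
    vset X = vset B ∪ (B.erase e0).biUnion (fun e => vset (g e) \ e) := by
  subst hX
  ext x
  rw [vset_union]
  simp only [Finset.mem_union, Finset.mem_biUnion, Finset.mem_sdiff]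
  constructor
  · rintro (h | h)
    · exact Or.inl h
    · obtain ⟨f, hf, hx⟩ := mem_vset.1 h
      obtain ⟨e, he, hfe⟩ := Finset.mem_biUnion.1 hf
      by_cases hxe : x ∈ e
      · exact Or.inl (mem_vset.2 ⟨e, Finset.mem_of_mem_erase he, hxe⟩)
      · exact Or.inr ⟨e, he, mem_vset.2 ⟨f, hfe, hx⟩, hxe⟩
  · rintro (h | ⟨e, he, hx, hxe⟩)
    · exact Or.inl h
    · right
      obtain ⟨f, hf, hxf⟩ := mem_vset.1 hx
      exact mem_vset.2 ⟨f, Finset.mem_biUnion.2 ⟨e, he, hf⟩, hxf⟩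

theorem int_card {k : ℕ} {F1 A : Finset (Finset ℕ)} {e : Finset ℕ} (hu1 : IsUniform k F1)
    (hA : IsCopy F1 A) (he : e ∈ A) : (vset A \ e).card = vcount F1 - k := by
  rw [Finset.card_sdiff_of_subset (sub_vset he), copy_uniform hA hu1 e he, ← copy_vcount hA]
  rfl

theorem gen_count {k : ℕ} {F1 F2 X : Finset (Finset ℕ)} (hu1 : IsUniform k F1)
    (h : IsGeneric F1 F2 X) :
    vcount X = vcount F2 + (F2.card - 1) * (vcount F1 - k) := by
  obtain ⟨B, e0, he0, hB, g, hg, hX, h1, h2⟩ := h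
  have hd1 : Disjoint (vset B) ((B.erase e0).biUnion (fun e => vset (g e) \ e)) := by
    rw [Finset.disjoint_left]
    intro x hx hx'
    obtain ⟨e, he, hxe⟩ := Finset.mem_biUnion.1 hx'
    rw [Finset.mem_sdiff] at hxe
    have : x ∈ vset (g e) ∩ vset B := Finset.mem_inter.2 ⟨hxe.1, hx⟩
    rw [h1 e he] at this
    exact hxe.2 this
  rw [vcount, vset_star hX, Finset.card_union_of_disjoint hd1, Finset.card_biUnion]
  · rw [Finset.sum_congr rfl (fun e he => int_card hu1 (hg e he).1 (hg e he).2)]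
    rw [Finset.sum_const, Finset.card_erase_of_mem he0, copy_card hB, smul_eq_mul]
    congr 1
    exact copy_vcount hB
  · intro e he e' he' hne
    exact Finset.disjoint_iff_inter_eq_empty.2 (h2 e he e' he' hne)

theorem star_gen {k : ℕ} {F1 F2 B X : Finset (Finset ℕ)} {e0 : Finset ℕ}
    {g : Finset ℕ → Finset (Finset ℕ)} (hu1 : IsUniform k F1)
    (he0 : e0 ∈ B) (hB : IsCopy F2 B)
    (hg : ∀ e ∈ B.erase e0, IsCopy F1 (g e) ∧ e ∈ g e)
    (hX : X = B ∪ (B.erase e0).biUnion g)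
    (hc : vcount X = vcount F2 + (F2.card - 1) * (vcount F1 - k)) :
    ∀ e ∈ B.erase e0, Disjoint (vset (g e) \ e) (vset B) ∧
      ∀ e' ∈ B.erase e0, e' ≠ e → Disjoint (vset (g e) \ e) (vset (g e') \ e') := by
  intro e he
  set U := vset B ∪ ((B.erase e0).erase e).biUnion (fun e => vset (g e) \ e) with hU
  have hdec : vset X = U ∪ (vset (g e) \ e) := by
    rw [vset_star hX, hU, Finset.union_assoc]
    congr 1
    conv_lhs => rw [← Finset.insert_erase he]
    rw [Finset.biUnion_insert, Finset.union_comm]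
  have hUc : U.card ≤ vcount F2 + (F2.card - 2) * (vcount F1 - k) := by
    refine (Finset.card_union_le _ _).trans ?_
    apply Nat.add_le_add
    · exact (copy_vcount hB).le
    · refine Finset.card_biUnion_le.trans ?_
      rw [Finset.sum_congr rfl (fun e he => int_card hu1 (hg e (Finset.mem_of_mem_erase he)).1
        (hg e (Finset.mem_of_mem_erase he)).2)]
      rw [Finset.sum_const, Finset.card_erase_of_mem he, Finset.card_erase_of_mem he0,
        copy_card hB, smul_eq_mul]
      rfl
  have hci := Finset.card_union_add_card_inter U (vset (g e) \ e)
  rw [← hdec, int_card hu1 (hg e he).1 (hg e he).2] at hci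
  change vcount X + _ = _ at hci
  have hF2 : 2 ≤ F2.card := by
    rw [← copy_card hB]
    exact Finset.one_lt_card.2 ⟨e, Finset.mem_of_mem_erase he, e0, he0, Finset.ne_of_mem_erase he⟩
  have hmul : (F2.card - 1) * (vcount F1 - k) =
      (F2.card - 2) * (vcount F1 - k) + (vcount F1 - k) := by
    have : F2.card - 1 = (F2.card - 2) + 1 := by omega
    rw [this, Nat.succ_mul]
  have h0 : (U ∩ (vset (g e) \ e)).card = 0 := by omega
  have hd : Disjoint (vset (g e) \ e) U := by
    rw [disjoint_comm, Finset.disjoint_iff_inter_eq_empty]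
    exact Finset.card_eq_zero.1 h0
  refine ⟨hd.mono_right Finset.subset_union_left, fun e' he' hne => hd.mono_right ?_⟩
  refine Finset.Subset.trans ?_ Finset.subset_union_right
  exact Finset.subset_biUnion_of_mem (fun e => vset (g e) \ e) (Finset.mem_erase.2 ⟨hne, he'⟩)

/-- A system of pendant copies of `F1` in `G` with independent interiors. -/
def PSys (F1 G : Finset (Finset ℕ)) (S : Finset (Finset (Finset ℕ) × Finset ℕ)) : Prop :=
  (∀ P ∈ S, Pend F1 G P.1 P.2) ∧
    ∀ P ∈ S, ∀ Q ∈ S, P ≠ Q → Disjoint (vset P.1 \ P.2) (vset Q.1)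

theorem psys_restrict {F1 G : Finset (Finset ℕ)} {S : Finset (Finset (Finset ℕ) × Finset ℕ)}
    (h : PSys F1 G S) (X : Finset (Finset ℕ)) :
    PSys F1 (G ∪ X) (S.filter (fun P => Disjoint (vset P.1 \ P.2) (vset X))) := by
  constructor
  · intro P hP
    rw [Finset.mem_filter] at hP
    obtain ⟨h1, h2, h3, h4⟩ := h.1 P hP.1
    refine ⟨h1, h2.trans Finset.subset_union_left, h3, fun f hf hfP => ?_⟩
    rcases Finset.mem_union.1 hf with hf | hf
    · exact h4 f hf hfP
    · exact (hP.2.mono_right (sub_vset hf)).symm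
  · intro P hP Q hQ hne
    exact h.2 P (Finset.mem_filter.1 hP).1 Q (Finset.mem_filter.1 hQ).1 hne

theorem psys_deg {F1 G : Finset (Finset ℕ)} {S : Finset (Finset (Finset ℕ) × Finset ℕ)}
    (h : PSys F1 G S) (X : Finset (Finset ℕ)) :
    ∃ S', PSys F1 (G ∪ X) S' ∧ S.card ≤ S'.card + vcount X := by
  refine ⟨_, psys_restrict h X, ?_⟩
  rw [← Finset.card_filter_add_card_filter_not
    (fun P : Finset (Finset ℕ) × Finset ℕ => Disjoint (vset P.1 \ P.2) (vset X)) (s := S)]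
  apply Nat.add_le_add_left
  have hex : ∀ P ∈ S.filter (fun P => ¬ Disjoint (vset P.1 \ P.2) (vset X)),
      ∃ x, x ∈ vset P.1 \ P.2 ∧ x ∈ vset X := by
    intro P hP
    exact Finset.not_disjoint_iff.1 (Finset.mem_filter.1 hP).2
  choose! φ hφ using hex
  refine Finset.card_le_card_of_injOn φ (fun P hP => (hφ P hP).2) ?_
  intro P hP Q hQ hPQ
  by_contra hne
  have hd := h.2 P (Finset.mem_filter.1 hP).1 Q (Finset.mem_filter.1 hQ).1 hne
  refine Finset.disjoint_left.1 hd (hφ P hP).1 ?_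
  have := (hφ Q hQ).1
  rw [← hPQ] at this
  exact (Finset.mem_sdiff.1 this).1

theorem psys_nondeg {k : ℕ} {F1 F2 G B X : Finset (Finset ℕ)} {e0 : Finset ℕ}
    {S : Finset (Finset (Finset ℕ) × Finset ℕ)}
    {g : Finset ℕ → Finset (Finset ℕ)} (hu1 : IsUniform k F1) (h2 : 2 ≤ F1.card)
    (h3 : 3 ≤ F2.card)
    (h : PSys F1 G S) (he0 : e0 ∈ B) (hB : IsCopy F2 B)
    (hg : ∀ e ∈ B.erase e0, IsCopy F1 (g e) ∧ e ∈ g e)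
    (hX : X = B ∪ (B.erase e0).biUnion g)
    (hc : vcount X = vcount F2 + (F2.card - 1) * (vcount F1 - k))
    (heG : e0 ∈ G) (hXG : vset X ∩ vset G = e0) :
    ∃ S', PSys F1 (G ∪ X) S' ∧ S.card + 1 ≤ S'.card := by
  have hgen := star_gen hu1 he0 hB hg hX hc
  have hBX : B ⊆ X := hX ▸ Finset.subset_union_left
  have hgX : ∀ e ∈ B.erase e0, g e ⊆ X := fun e he => by
    rw [hX]
    exact (Finset.subset_biUnion_of_mem g he).trans Finset.subset_union_right
  -- interiors of new copies avoid `vset G`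
  have hintG : ∀ e ∈ B.erase e0, Disjoint (vset (g e) \ e) (vset G) := by
    intro e he
    rw [Finset.disjoint_left]
    intro x hx hxG
    have hx1 : x ∈ vset X := vset_mono (hgX e he) (Finset.mem_sdiff.1 hx).1
    have hx2 : x ∈ e0 := hXG ▸ Finset.mem_inter.2 ⟨hx1, hxG⟩
    exact Finset.disjoint_left.1 (hgen e he).1 hx (sub_vset he0 hx2)
  have hintg : ∀ e ∈ B.erase e0, ∀ e' ∈ B.erase e0, e ≠ e' →
      Disjoint (vset (g e) \ e) (vset (g e')) := by
    intro e he e' he' hne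
    rw [Finset.disjoint_left]
    intro x hx hx'
    by_cases hxe : x ∈ e'
    · exact Finset.disjoint_left.1 (hgen e he).1 hx
        (sub_vset (Finset.mem_of_mem_erase he') hxe)
    · exact Finset.disjoint_left.1 ((hgen e he).2 e' he' hne.symm) hx
        (Finset.mem_sdiff.2 ⟨hx', hxe⟩)
  set S1 := S.filter (fun P => Disjoint (vset P.1 \ P.2) (vset X)) with hS1
  set N := (B.erase e0).image (fun e => (g e, e)) with hN
  have hr := psys_restrict h X
  rw [← hS1] at hr
  have hNc : N.card = F2.card - 1 := by
    rw [hN, Finset.card_image_of_injective _ (fun a b hab => (Prod.mk.inj hab).2),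
      Finset.card_erase_of_mem he0, copy_card hB]
  have hnotmem : ∀ P ∈ S, ∀ e ∈ B.erase e0, P ≠ (g e, e) := by
    rintro P hP e he rfl
    have hp := h.1 _ hP
    obtain ⟨f, hf, hfe⟩ : ∃ f ∈ g e, f ≠ e := by
      have : 1 < (g e).card := by rw [copy_card (hg e he).1]; omega
      exact Finset.exists_mem_ne this e
    have hu := copy_uniform (hg e he).1 hu1
    have hns : ¬ f ⊆ e := fun hs => hfe (Finset.eq_of_subset_of_card_le hs (by
      rw [hu f hf, hu e (hg e he).2]))
    obtain ⟨x, hx, hxe⟩ := Finset.not_subset.1 hns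
    exact Finset.disjoint_left.1 (hintG e he)
      (Finset.mem_sdiff.2 ⟨sub_vset hf hx, hxe⟩) (sub_vset (hp.2.1 hf) hx)
  refine ⟨S1 ∪ N, ⟨?_, ?_⟩, ?_⟩
  · intro P hP
    rcases Finset.mem_union.1 hP with hP | hP
    · exact hr.1 P hP
    · obtain ⟨e, he, rfl⟩ := Finset.mem_image.1 hP
      refine ⟨(hg e he).1, (hgX e he).trans Finset.subset_union_right, (hg e he).2, ?_⟩
      intro f hf hfe
      rcases Finset.mem_union.1 hf with hf | hf
      · exact ((hintG e he).mono_right (sub_vset hf)).symm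
      · rw [hX] at hf
        rcases Finset.mem_union.1 hf with hf | hf
        · exact ((hgen e he).1.mono_right (sub_vset hf)).symm
        · obtain ⟨e', he', hf'⟩ := Finset.mem_biUnion.1 hf
          have hne : e ≠ e' := by rintro rfl; exact hfe hf'
          exact ((hintg e he e' he' hne).mono_right (sub_vset hf')).symm
  · intro P hP Q hQ hne
    rcases Finset.mem_union.1 hP with hP | hP <;> rcases Finset.mem_union.1 hQ with hQ | hQ
    · exact hr.2 P hP Q hQ hne
    · obtain ⟨e, he, rfl⟩ := Finset.mem_image.1 hQ
      exact (Finset.mem_filter.1 hP).2.mono_right (vset_mono (hgX e he))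
    · obtain ⟨e, he, rfl⟩ := Finset.mem_image.1 hP
      exact (hintG e he).mono_right (vset_mono (h.1 Q (Finset.mem_filter.1 hQ).1).2.1)
    · obtain ⟨e, he, rfl⟩ := Finset.mem_image.1 hP
      obtain ⟨e', he', rfl⟩ := Finset.mem_image.1 hQ
      exact hintg e he e' he' (by rintro rfl; exact hne rfl)
  · have hd : Disjoint S1 N := by
      rw [Finset.disjoint_left]
      intro P hP hPN
      obtain ⟨e, he, rfl⟩ := Finset.mem_image.1 hPN
      exact hnotmem _ (Finset.mem_filter.1 hP).1 e he rfl
    rw [Finset.card_union_of_disjoint hd, hNc]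
    have h1 := Finset.card_filter_add_card_filter_not
      (fun P : Finset (Finset ℕ) × Finset ℕ => Disjoint (vset P.1 \ P.2) (vset X)) (s := S)
    rw [← hS1] at h1
    have h2 : (S.filter (fun P => ¬ Disjoint (vset P.1 \ P.2) (vset X))).card ≤ 1 := by
      have key : ∀ P ∈ S, ¬ Disjoint (vset P.1 \ P.2) (vset X) →
          e0 ∈ P.1 ∧ ∃ x ∈ e0, x ∈ vset P.1 \ P.2 := by
        intro P hP hnd
        obtain ⟨x, hx, hxX⟩ := Finset.not_disjoint_iff.1 hnd
        have hp := h.1 P hP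
        have hxe : x ∈ e0 := by
          rw [← hXG]
          exact Finset.mem_inter.2 ⟨hxX, vset_mono hp.2.1 (Finset.mem_sdiff.1 hx).1⟩
        refine ⟨?_, x, hxe, hx⟩
        by_contra hn
        exact Finset.disjoint_left.1 (hp.2.2.2 e0 heG hn) hxe hx
      rw [Finset.card_le_one]
      intro P hP Q hQ
      rw [Finset.mem_filter] at hP hQ
      by_contra hne
      obtain ⟨-, x, hx, hxP⟩ := key P hP.1 hP.2
      obtain ⟨hQe, -⟩ := key Q hQ.1 hQ.2
      exact Finset.disjoint_left.1 (h.2 P hP.1 Q hQ.1 hne) hxP (sub_vset hQe hx)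
    omega


theorem prob_true (k n : ℕ) (p : ℝ) (P : Finset (Finset ℕ) → Prop) :
    prob k n p P + prob k n p (fun H => ¬ P H) = 1 := by
  rw [prob, prob, ← Finset.sum_add_distrib]
  have h := Finset.sum_pow_mul_eq_add_pow p (1 - p) (allEdges k n)
  rw [add_sub_cancel, one_pow] at h
  refine Eq.trans ?_ h
  apply Finset.sum_congr rfl
  intro G _
  by_cases hP : P G <;> simp [hP]

theorem w_nonneg {p : ℝ} (h0 : 0 ≤ p) (h1 : p ≤ 1) (a b : ℕ) : 0 ≤ p ^ a * (1 - p) ^ b :=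
  mul_nonneg (pow_nonneg h0 _) (pow_nonneg (by linarith) _)

theorem prob_nonneg {k n : ℕ} {p : ℝ} (h0 : 0 ≤ p) (h1 : p ≤ 1)
    (P : Finset (Finset ℕ) → Prop) : 0 ≤ prob k n p P := by
  apply Finset.sum_nonneg
  intro G _
  split_ifs
  · exact w_nonneg h0 h1 _ _
  · exact le_rfl

theorem prob_mono {k n : ℕ} {p : ℝ} (h0 : 0 ≤ p) (h1 : p ≤ 1)
    {P Q : Finset (Finset ℕ) → Prop} (h : ∀ H ⊆ allEdges k n, P H → Q H) :
    prob k n p P ≤ prob k n p Q := by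
  apply Finset.sum_le_sum
  intro G hG
  have hG' := h G (Finset.mem_powerset.1 hG)
  have := w_nonneg h0 h1 G.card ((allEdges k n).card - G.card)
  by_cases hP : P G
  · simp [hP, hG' hP]
  · by_cases hQ : Q G <;> simp [hP, hQ, this]

theorem prob_or {k n : ℕ} {p : ℝ} (h0 : 0 ≤ p) (h1 : p ≤ 1)
    (P Q : Finset (Finset ℕ) → Prop) :
    prob k n p (fun H => P H ∨ Q H) ≤ prob k n p P + prob k n p Q := by
  rw [prob, prob, prob, ← Finset.sum_add_distrib]
  apply Finset.sum_le_sum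
  intro G hG
  have := w_nonneg h0 h1 G.card ((allEdges k n).card - G.card)
  by_cases hP : P G <;> by_cases hQ : Q G <;> simp [hP, hQ, this]

theorem prob_ex {α : Type*} {k n : ℕ} {p : ℝ} (h0 : 0 ≤ p) (h1 : p ≤ 1) (S : Finset α)
    (P : α → Finset (Finset ℕ) → Prop) :
    prob k n p (fun H => ∃ x ∈ S, P x H) ≤ ∑ x ∈ S, prob k n p (P x) := by
  simp only [prob]
  rw [Finset.sum_comm]
  apply Finset.sum_le_sum
  intro G hG
  have hw := w_nonneg h0 h1 G.card ((allEdges k n).card - G.card)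
  have hn : ∀ x ∈ S, 0 ≤ (if P x G then p ^ G.card * (1 - p) ^ ((allEdges k n).card - G.card)
      else 0) := by
    intro x _
    split_ifs
    · exact hw
    · exact le_rfl
  split_ifs with h
  · obtain ⟨x, hx, hP⟩ := h
    refine le_trans ?_ (Finset.single_le_sum hn hx)
    rw [if_pos hP]
  · exact Finset.sum_nonneg hn

theorem prob_contains {k n : ℕ} {p : ℝ} (h0 : 0 ≤ p) (G : Finset (Finset ℕ)) :
    prob k n p (fun H => G ⊆ H) ≤ p ^ G.card := by
  by_cases hG : G ⊆ allEdges k n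
  · apply le_of_eq
    have e1 : prob k n p (fun H => G ⊆ H) = ∑ H ∈ (allEdges k n).powerset.filter
        (fun H => G ⊆ H), p ^ H.card * (1 - p) ^ ((allEdges k n).card - H.card) := by
      rw [Finset.sum_filter, prob]
      apply Finset.sum_congr rfl
      intro H _
      by_cases hh : G ⊆ H <;> simp [hh]
    rw [e1]
    have h := Finset.sum_pow_mul_eq_add_pow p (1 - p) (allEdges k n \ G)
    rw [add_sub_cancel, one_pow] at h
    have h' : p ^ G.card = ∑ t ∈ (allEdges k n \ G).powerset,
        p ^ G.card * (p ^ t.card * (1 - p) ^ ((allEdges k n \ G).card - t.card)) := by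
      rw [← Finset.mul_sum, h, mul_one]
    refine Eq.trans ?_ h'.symm
    apply Finset.sum_nbij' (fun H => H \ G) (fun H => H ∪ G)
    · intro H hH
      simp only [Finset.mem_filter, Finset.mem_powerset] at hH ⊢
      exact Finset.sdiff_subset_sdiff hH.1 subset_rfl
    · intro H hH
      simp only [Finset.mem_filter, Finset.mem_powerset] at hH ⊢
      exact ⟨Finset.union_subset (hH.trans Finset.sdiff_subset) hG, Finset.subset_union_right⟩
    · intro H hH
      simp only [Finset.mem_filter, Finset.mem_powerset] at hH
      exact Finset.sdiff_union_of_subset hH.2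
    · intro H hH
      simp only [Finset.mem_powerset] at hH
      rw [Finset.union_sdiff_right]
      exact Finset.sdiff_eq_self_of_disjoint (Finset.disjoint_of_subset_left hH
        Finset.sdiff_disjoint)
    · intro H hH
      simp only [Finset.mem_filter, Finset.mem_powerset] at hH
      rw [Finset.card_sdiff_of_subset hG, Finset.card_sdiff_of_subset hH.2, ← mul_assoc,
        ← pow_add]
      have h1 := Finset.card_le_card hH.2
      have h2 := Finset.card_le_card hH.1
      rw [show G.card + (H.card - G.card) = H.card by omega,
        show (allEdges k n).card - G.card - (H.card - G.card) = (allEdges k n).card - H.card by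
          omega]
  · have : prob k n p (fun H => G ⊆ H) = 0 := by
      apply Finset.sum_eq_zero
      intro H hH
      rw [if_neg]
      intro h
      exact hG (h.trans (Finset.mem_powerset.1 hH))
    rw [this]
    exact pow_nonneg h0 _

noncomputable def pick (G D : Finset (Finset ℕ)) : Finset ℕ :=
  if h : (G \ D).Nonempty then h.choose else ∅

theorem pick_mem {G D : Finset (Finset ℕ)} (h : (G \ D).Nonempty) : pick G D ∈ G \ D := by
  rw [pick, dif_pos h]; exact h.choose_spec

/-- possible non-degenerate extensions -/
noncomputable def NdSet (k n K : ℕ) (θ : ℝ) (G : Finset (Finset ℕ)) (e : Finset ℕ) :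
    Finset (Finset (Finset ℕ)) :=
  (allEdges k n).powerset.filter (fun X => vcount X ≤ K ∧ vset X ∩ vset G = e ∧
    (X \ G).Nonempty ∧ ((vset X \ vset G).card : ℝ) ≤ θ * ((X \ G).card : ℝ))

/-- possible degenerate extensions -/
noncomputable def DgSet (k n K : ℕ) (θ ε : ℝ) (G : Finset (Finset ℕ)) :
    Finset (Finset (Finset ℕ)) :=
  (allEdges k n).powerset.filter (fun X => vcount X ≤ K ∧
    (X \ G).Nonempty ∧ ((vset X \ vset G).card : ℝ) + ε ≤ θ * ((X \ G).card : ℝ))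

/-- exploration from the state `(G, D)` runs for `s` operations or makes `d` degenerate steps -/
def Bad (k n K : ℕ) (θ ε : ℝ) (H : Finset (Finset ℕ)) :
    ℕ → ℕ → Finset (Finset ℕ) → Finset (Finset ℕ) → Prop
  | 0, _, G, _ => G ⊆ H
  | _ + 1, 0, G, _ => G ⊆ H
  | s + 1, d + 1, G, D =>
      ((pick G D ∈ G \ D) ∧ Bad k n K θ ε H s (d + 1) G (insert (pick G D) D)) ∨
      ((∃ X ∈ NdSet k n K θ G (pick G D), Bad k n K θ ε H s (d + 1) (G ∪ X) D) ∨
      (∃ X ∈ DgSet k n K θ ε G, Bad k n K θ ε H s d (G ∪ X) D))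

theorem card_union_sdiff' (G X : Finset (Finset ℕ)) : (G ∪ X).card = G.card + (X \ G).card := by
  rw [← Finset.union_sdiff_self_eq_union, Finset.card_union_of_disjoint Finset.disjoint_sdiff]

theorem weight_step {p : ℝ} (h0 : 0 ≤ p) (G X D : Finset (Finset ℕ)) :
    p ^ (G ∪ X).card * 2 ^ ((G ∪ X) \ D).card ≤
      (p ^ G.card * 2 ^ (G \ D).card) * (2 * p) ^ (X \ G).card := by
  have h1 : ((G ∪ X) \ D).card ≤ (G \ D).card + (X \ G).card := by
    refine (Finset.card_le_card (t := (G \ D) ∪ (X \ G)) ?_).trans (Finset.card_union_le _ _)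
    intro x
    simp only [Finset.mem_sdiff, Finset.mem_union]
    tauto
  rw [card_union_sdiff', pow_add, mul_pow]
  have h2 : (2 : ℝ) ^ ((G ∪ X) \ D).card ≤ 2 ^ (G \ D).card * 2 ^ (X \ G).card := by
    rw [← pow_add]; exact pow_le_pow_right₀ (by norm_num) h1
  calc _ ≤ p ^ G.card * p ^ (X \ G).card * (2 ^ (G \ D).card * 2 ^ (X \ G).card) :=
        mul_le_mul_of_nonneg_left h2 (by positivity)
    _ = _ := by ring

theorem bad_bound {k n K M : ℕ} {θ ε p η : ℝ} (h0 : 0 ≤ p) (h1 : p ≤ 1)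
    (hη0 : 0 ≤ η) (hη : η ≤ 1 / 8)
    (hnd : ∀ G e, ∑ X ∈ NdSet k n K θ G e, (2 * p) ^ (X \ G).card ≤ 1 / 8)
    (hdg : ∀ G, vcount G ≤ M → ∑ X ∈ DgSet k n K θ ε G, (2 * p) ^ (X \ G).card ≤ η) :
    ∀ s d G D, vcount G + K * s ≤ M →
      prob k n p (fun H => Bad k n K θ ε H s d G D) ≤
        (p ^ G.card * 2 ^ (G \ D).card) * ((3 / 4) ^ s + (8 * η) ^ d) := by
  have base : ∀ (G D : Finset (Finset ℕ)) (x : ℝ), 1 ≤ x → prob k n p (fun H => G ⊆ H) ≤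
      (p ^ G.card * 2 ^ (G \ D).card) * x := by
    intro G D x hx
    refine (prob_contains h0 G).trans ?_
    have : (1 : ℝ) ≤ 2 ^ (G \ D).card := one_le_pow₀ (by norm_num)
    have h3 := mul_le_mul this hx zero_le_one (by positivity)
    calc p ^ G.card = p ^ G.card * (1 * 1) := by ring
      _ ≤ p ^ G.card * (2 ^ (G \ D).card * x) := mul_le_mul_of_nonneg_left h3 (by positivity)
      _ = _ := by ring
  intro s
  induction s with
  | zero =>
    intro d G D _
    simp only [Bad]
    apply base
    have : 0 ≤ (8 * η) ^ d := by positivity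
    simpa using this
  | succ s ih =>
    intro d G D hv
    cases d with
    | zero =>
      simp only [Bad]
      apply base
      have : (0 : ℝ) ≤ (3 / 4) ^ (s + 1) := by positivity
      simpa using this
    | succ d =>
      simp only [Bad]
      set W := p ^ G.card * 2 ^ (G \ D).card with hW
      have hW0 : 0 ≤ W := by positivity
      have hvX : ∀ X, vcount X ≤ K → vcount (G ∪ X) + K * s ≤ M := by
        intro X hX
        have : vcount (G ∪ X) ≤ vcount G + vcount X := by
          rw [vcount, vset_union]; exact Finset.card_union_le _ _
        have : K * (s + 1) = K * s + K := by ring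
        omega
      set b1 : ℝ := (3 / 4) ^ s + (8 * η) ^ (d + 1) with hb1
      set b2 : ℝ := (3 / 4) ^ s + (8 * η) ^ d with hb2
      have hb10 : 0 ≤ b1 := by positivity
      have hb20 : 0 ≤ b2 := by positivity
      have t1 : prob k n p (fun H => (pick G D ∈ G \ D) ∧
          Bad k n K θ ε H s (d + 1) G (insert (pick G D) D)) ≤ W * (1 / 2) * b1 := by
        by_cases hp : pick G D ∈ G \ D
        · refine (prob_mono h0 h1 (Q := fun H => Bad k n K θ ε H s (d + 1) G
            (insert (pick G D) D)) (fun H _ h => h.2)).trans ?_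
          refine (ih (d + 1) G (insert (pick G D) D) (by
            have : K * (s + 1) = K * s + K := by ring
            omega)).trans ?_
          have hc : (G \ D).card = (G \ insert (pick G D) D).card + 1 := by
            rw [Finset.sdiff_insert, Finset.card_erase_of_mem hp]
            have := Finset.card_pos.2 ⟨_, hp⟩
            omega
          apply le_of_eq
          rw [hW, hc, pow_succ]
          ring
        · have : prob k n p (fun H => (pick G D ∈ G \ D) ∧
            Bad k n K θ ε H s (d + 1) G (insert (pick G D) D)) = 0 := by
            apply Finset.sum_eq_zero
            intro H _
            rw [if_neg]
            exact fun h => hp h.1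
          rw [this]; positivity
      have t2 : prob k n p (fun H => ∃ X ∈ NdSet k n K θ G (pick G D),
          Bad k n K θ ε H s (d + 1) (G ∪ X) D) ≤ W * (1 / 8) * b1 := by
        refine (prob_ex h0 h1 _ _).trans ?_
        calc _ ≤ ∑ X ∈ NdSet k n K θ G (pick G D), W * (2 * p) ^ (X \ G).card * b1 := by
              apply Finset.sum_le_sum
              intro X hX
              refine (ih (d + 1) (G ∪ X) D (hvX X (Finset.mem_filter.1 hX).2.1)).trans ?_
              exact mul_le_mul_of_nonneg_right (weight_step h0 G X D) hb10
          _ = W * (∑ X ∈ NdSet k n K θ G (pick G D), (2 * p) ^ (X \ G).card) * b1 := by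
              rw [Finset.mul_sum, Finset.sum_mul]
          _ ≤ _ := by
              gcongr
              exact hnd G _
      have t3 : prob k n p (fun H => ∃ X ∈ DgSet k n K θ ε G,
          Bad k n K θ ε H s d (G ∪ X) D) ≤ W * η * b2 := by
        refine (prob_ex h0 h1 _ _).trans ?_
        calc _ ≤ ∑ X ∈ DgSet k n K θ ε G, W * (2 * p) ^ (X \ G).card * b2 := by
              apply Finset.sum_le_sum
              intro X hX
              refine (ih d (G ∪ X) D (hvX X (Finset.mem_filter.1 hX).2.1)).trans ?_
              exact mul_le_mul_of_nonneg_right (weight_step h0 G X D) hb20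
          _ = W * (∑ X ∈ DgSet k n K θ ε G, (2 * p) ^ (X \ G).card) * b2 := by
              rw [Finset.mul_sum, Finset.sum_mul]
          _ ≤ _ := by
              gcongr
              exact hdg G (by omega)
      refine (prob_or h0 h1 _ _).trans ?_
      refine (add_le_add t1 ((prob_or h0 h1 _ _).trans (add_le_add t2 t3))).trans ?_
      have hfin : 1 / 2 * b1 + (1 / 8 * b1 + η * b2) ≤ (3 / 4) ^ (s + 1) + (8 * η) ^ (d + 1) := by
        rw [hb1, hb2, pow_succ (3 / 4 : ℝ) s, pow_succ (8 * η) d]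
        have q1 : (0 : ℝ) ≤ (3 / 4) ^ s := by positivity
        have q2 := mul_le_mul_of_nonneg_left hη q1
        have q3 : 0 ≤ (8 * η) ^ d * η := by positivity
        linarith
      calc _ = W * (1 / 2 * b1 + (1 / 8 * b1 + η * b2)) := by ring
        _ ≤ _ := mul_le_mul_of_nonneg_left hfin hW0


/-- subsets of size at most `K` -/
noncomputable def smallSub (K : ℕ) (S : Finset ℕ) : Finset (Finset ℕ) :=
  (Finset.range (K + 1)).biUnion (fun j => S.powersetCard j)

theorem mem_smallSub {K : ℕ} {S Y : Finset ℕ} : Y ∈ smallSub K S ↔ Y ⊆ S ∧ Y.card ≤ K := by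
  simp only [smallSub, Finset.mem_biUnion, Finset.mem_range, Finset.mem_powersetCard]
  constructor
  · rintro ⟨j, hj, h, rfl⟩; exact ⟨h, by omega⟩
  · rintro ⟨h, hc⟩; exact ⟨Y.card, by omega, h, rfl⟩

theorem card_smallSub (K : ℕ) (S : Finset ℕ) :
    (smallSub K S).card ≤ (K + 1) * (S.card + 1) ^ K := by
  refine Finset.card_biUnion_le.trans ?_
  calc _ ≤ ∑ _j ∈ Finset.range (K + 1), (S.card + 1) ^ K := by
        apply Finset.sum_le_sum
        intro j hj
        rw [Finset.card_powersetCard]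
        refine (Nat.choose_le_pow _ _).trans ?_
        refine (Nat.pow_le_pow_left (Nat.le_succ _) j).trans ?_
        exact Nat.pow_le_pow_right (Nat.succ_pos _) (by simp at hj; omega)
    _ = _ := by simp

theorem sum_smallSub (K n : ℕ) (hn : 1 ≤ n) :
    ∑ Y ∈ smallSub K (Finset.range n), ((n : ℝ)⁻¹) ^ Y.card ≤ K + 1 := by
  rw [smallSub, Finset.sum_biUnion]
  · calc _ ≤ ∑ _j ∈ Finset.range (K + 1), (1 : ℝ) := by
          apply Finset.sum_le_sum
          intro j _
          rw [Finset.sum_congr rfl (fun Y hY => by rw [(Finset.mem_powersetCard.1 hY).2])]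
          rw [Finset.sum_const, Finset.card_powersetCard, Finset.card_range, nsmul_eq_mul,
            inv_pow, ← div_eq_mul_inv]
          have : (0 : ℝ) < (n : ℝ) ^ j := by positivity
          rw [div_le_one this]
          exact_mod_cast Nat.choose_le_pow n j
      _ = _ := by simp
  · intro i _ j _ hij
    exact Finset.pairwise_disjoint_powersetCard _ hij

theorem vset_allEdges {k n : ℕ} {X : Finset (Finset ℕ)} (h : X ⊆ allEdges k n) :
    vset X ⊆ Finset.range n := by
  intro x hx
  obtain ⟨e, he, hx⟩ := mem_vset.1 hx
  exact (Finset.mem_powersetCard.1 (h he)).1 hx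

theorem count_ext {k n K : ℕ} (hn : 1 ≤ n) (G : Finset (Finset ℕ)) (Ys : Finset (Finset ℕ))
    (T : Finset (Finset (Finset ℕ)))
    (hT : ∀ X ∈ T, X ⊆ allEdges k n ∧ vcount X ≤ K ∧ vset X ∩ vset G ∈ Ys) :
    ∑ X ∈ T, ((n : ℝ)⁻¹) ^ (vset X \ vset G).card ≤ Ys.card * ((K + 1) * 2 ^ 2 ^ K) := by
  have hmaps : ∀ X ∈ T, (vset X ∩ vset G, vset X \ vset G) ∈
      Ys ×ˢ smallSub K (Finset.range n) := by
    intro X hX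
    obtain ⟨h1, h2, h3⟩ := hT X hX
    rw [Finset.mem_product]
    refine ⟨h3, mem_smallSub.2 ⟨Finset.sdiff_subset.trans (vset_allEdges h1), ?_⟩⟩
    exact (Finset.card_le_card Finset.sdiff_subset).trans h2
  rw [← Finset.sum_fiberwise_of_maps_to hmaps]
  calc _ ≤ ∑ Y ∈ Ys ×ˢ smallSub K (Finset.range n), (2 : ℝ) ^ 2 ^ K * ((n : ℝ)⁻¹) ^ Y.2.card := by
        apply Finset.sum_le_sum
        intro Y _
        calc _ = ∑ X ∈ T.filter (fun X => (vset X ∩ vset G, vset X \ vset G) = Y),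
                ((n : ℝ)⁻¹) ^ Y.2.card := by
              apply Finset.sum_congr rfl
              intro X hX
              rw [← (Finset.mem_filter.1 hX).2]
          _ = ((T.filter (fun X => (vset X ∩ vset G, vset X \ vset G) = Y)).card : ℝ) *
                ((n : ℝ)⁻¹) ^ Y.2.card := by rw [Finset.sum_const, nsmul_eq_mul]
          _ ≤ _ := by
              apply mul_le_mul_of_nonneg_right _ (by positivity)
              rcases Finset.eq_empty_or_nonempty
                (T.filter (fun X => (vset X ∩ vset G, vset X \ vset G) = Y)) with h | h
              · rw [h]; simp
              · obtain ⟨X0, hX0⟩ := h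
                have hfib : ∀ X ∈ T.filter (fun X => (vset X ∩ vset G, vset X \ vset G) = Y),
                    vset X = Y.1 ∪ Y.2 := by
                  intro X hX
                  rw [← (Finset.mem_filter.1 hX).2]
                  ext x; simp; tauto
                have hc : (Y.1 ∪ Y.2).card ≤ K := by
                  rw [← hfib X0 hX0]; exact (hT X0 (Finset.mem_filter.1 hX0).1).2.1
                have hs : T.filter (fun X => (vset X ∩ vset G, vset X \ vset G) = Y) ⊆
                    (Y.1 ∪ Y.2).powerset.powerset := by
                  intro X hX
                  rw [Finset.mem_powerset]
                  intro e he
                  rw [Finset.mem_powerset, ← hfib X hX]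
                  exact sub_vset he
                have h4 := Finset.card_le_card hs
                rw [Finset.card_powerset, Finset.card_powerset] at h4
                have h5 : 2 ^ 2 ^ (Y.1 ∪ Y.2).card ≤ 2 ^ 2 ^ K :=
                  Nat.pow_le_pow_right (by norm_num) (Nat.pow_le_pow_right (by norm_num) hc)
                exact_mod_cast h4.trans h5
    _ = Ys.card * (2 ^ 2 ^ K * ∑ Y ∈ smallSub K (Finset.range n), ((n : ℝ)⁻¹) ^ Y.card) := by
        rw [Finset.sum_product]
        simp only [Finset.sum_const, nsmul_eq_mul, ← Finset.mul_sum]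
    _ ≤ Ys.card * (2 ^ 2 ^ K * (K + 1)) := by
        gcongr
        exact sum_smallSub K n hn
    _ = _ := by ring

theorem pow_bound {n : ℕ} (hn : 1 ≤ n) {c θ ε p : ℝ} (hc0 : 0 < c) (hc : 2 * c ≤ 1)
    (hp0 : 0 ≤ p) (hp : p ≤ c * (n : ℝ) ^ (-θ)) {a b : ℕ} (hb : 1 ≤ b)
    (hab : (a : ℝ) + ε ≤ θ * b) :
    (2 * p) ^ b ≤ 2 * c * (n : ℝ) ^ (-ε) * ((n : ℝ)⁻¹) ^ a := by
  have hn' : (1 : ℝ) ≤ n := by exact_mod_cast hn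
  have hn0 : (0 : ℝ) < n := by linarith
  calc (2 * p) ^ b ≤ (2 * (c * (n : ℝ) ^ (-θ))) ^ b := by gcongr
    _ = (2 * c) ^ b * (n : ℝ) ^ (-(θ * b)) := by
        rw [← mul_assoc, mul_pow, ← Real.rpow_natCast ((n : ℝ) ^ (-θ)), ← Real.rpow_mul hn0.le]
        congr 2; ring
    _ ≤ (2 * c) * (n : ℝ) ^ (-ε - a) := by
        apply mul_le_mul
        · exact pow_le_of_le_one (by linarith) hc (by omega)
        · exact Real.rpow_le_rpow_of_exponent_le hn' (by linarith)
        · positivity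
        · linarith
    _ = _ := by
        rw [Real.rpow_sub hn0, Real.rpow_natCast, inv_pow]
        ring

theorem nd_bound {k n K : ℕ} (hn : 1 ≤ n) {c θ p : ℝ} (hc0 : 0 < c)
    (hc : 2 * c * ((K + 1) * 2 ^ 2 ^ K) ≤ 1 / 8) (hc1 : 2 * c ≤ 1)
    (hp0 : 0 ≤ p) (hp : p ≤ c * (n : ℝ) ^ (-θ)) (G : Finset (Finset ℕ)) (e : Finset ℕ) :
    ∑ X ∈ NdSet k n K θ G e, (2 * p) ^ (X \ G).card ≤ 1 / 8 := by
  have h := count_ext (k := k) (K := K) hn G {e} (NdSet k n K θ G e) (by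
    intro X hX
    simp only [NdSet, Finset.mem_filter, Finset.mem_powerset] at hX
    exact ⟨hX.1, hX.2.1, by simp [hX.2.2.1]⟩)
  calc _ ≤ ∑ X ∈ NdSet k n K θ G e, 2 * c * ((n : ℝ)⁻¹) ^ (vset X \ vset G).card := by
        apply Finset.sum_le_sum
        intro X hX
        simp only [NdSet, Finset.mem_filter, Finset.mem_powerset] at hX
        have := pow_bound hn (ε := 0) hc0 hc1 hp0 hp (a := (vset X \ vset G).card)
          hX.2.2.2.1.card_pos (by simpa using hX.2.2.2.2)
        simpa using this
    _ = 2 * c * ∑ X ∈ NdSet k n K θ G e, ((n : ℝ)⁻¹) ^ (vset X \ vset G).card := by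
        rw [Finset.mul_sum]
    _ ≤ 2 * c * ((K + 1) * 2 ^ 2 ^ K) := by
        gcongr
        simpa using h
    _ ≤ _ := hc

theorem dg_bound {k n K M : ℕ} (hn : 1 ≤ n) {c θ ε p : ℝ} (hc0 : 0 < c)
    (hc : 2 * c * ((K + 1) * 2 ^ 2 ^ K) ≤ 1 / 8) (hc1 : 2 * c ≤ 1)
    (hp0 : 0 ≤ p) (hp : p ≤ c * (n : ℝ) ^ (-θ)) (G : Finset (Finset ℕ)) (hG : vcount G ≤ M) :
    ∑ X ∈ DgSet k n K θ ε G, (2 * p) ^ (X \ G).card ≤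
      1 / 8 * ((K + 1) * (M + 1) ^ K * (n : ℝ) ^ (-ε)) := by
  have h := count_ext (k := k) (K := K) hn G (smallSub K (vset G)) (DgSet k n K θ ε G) (by
    intro X hX
    simp only [DgSet, Finset.mem_filter, Finset.mem_powerset] at hX
    exact ⟨hX.1, hX.2.1, mem_smallSub.2 ⟨Finset.inter_subset_right,
      (Finset.card_le_card Finset.inter_subset_left).trans hX.2.1⟩⟩)
  have hcard : ((smallSub K (vset G)).card : ℝ) ≤ (K + 1) * (M + 1) ^ K := by
    have h1 := card_smallSub K (vset G)
    have h2 : (K + 1) * ((vset G).card + 1) ^ K ≤ (K + 1) * (M + 1) ^ K := by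
      gcongr; exact hG
    exact_mod_cast h1.trans h2
  have hn0 : (0 : ℝ) ≤ (n : ℝ) ^ (-ε) := by positivity
  calc _ ≤ ∑ X ∈ DgSet k n K θ ε G,
          2 * c * (n : ℝ) ^ (-ε) * ((n : ℝ)⁻¹) ^ (vset X \ vset G).card := by
        apply Finset.sum_le_sum
        intro X hX
        simp only [DgSet, Finset.mem_filter, Finset.mem_powerset] at hX
        exact pow_bound hn hc0 hc1 hp0 hp hX.2.2.1.card_pos hX.2.2.2
    _ = 2 * c * (n : ℝ) ^ (-ε) *
          ∑ X ∈ DgSet k n K θ ε G, ((n : ℝ)⁻¹) ^ (vset X \ vset G).card := by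
        rw [Finset.mul_sum]
    _ ≤ 2 * c * (n : ℝ) ^ (-ε) * ((smallSub K (vset G)).card * ((K + 1) * 2 ^ 2 ^ K)) := by
        gcongr
    _ = (2 * c * ((K + 1) * 2 ^ 2 ^ K)) * ((smallSub K (vset G)).card * (n : ℝ) ^ (-ε)) := by
        ring
    _ ≤ _ := by
        gcongr

theorem mkA_pos {k : ℕ} {F1 F2 : Finset (Finset ℕ)} (hne : F1.Nonempty) (hu1 : IsUniform k F1)
    (hm2 : 1 ≤ mk k F2) (h : StrictlyBalancedWrt k F1 F2) : 0 < mkA k F1 F2 := by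
  rw [mkA_eq hne h]
  have h1 : (k : ℝ) ≤ vcount F1 := by exact_mod_cast vcount_ge hu1 hne
  have h2 : 0 < 1 / mk k F2 := by positivity
  have h3 : (0 : ℝ) < F1.card := by exact_mod_cast hne.card_pos
  apply div_pos h3; linarith

theorem f1_card {k : ℕ} {F1 F2 : Finset (Finset ℕ)}
    (hu1 : IsUniform k F1) (hu2 : IsUniform k F2)
    (h3 : 3 ≤ F2.card)
    (h12 : mk k F2 ≤ mk k F1) (hge1 : 1 ≤ mk k F2)
    (hbal1 : StrictlyKBalanced k F1) (hbal2 : StrictlyKBalanced k F2) : 2 ≤ F1.card := by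
  by_contra hcon
  have hc : F1.card = 0 ∨ F1.card = 1 := by omega
  rw [mk_eq hbal1] at h12
  rcases hc with hc | hc
  · rw [dk, if_pos hc] at h12; linarith
  · obtain ⟨e, rfl⟩ := Finset.card_eq_one.1 hc
    have hv : vcount {e} = k := by
      rw [vcount, vset_single]; exact hu1 e (by simp)
    rw [dk, if_neg (by omega), if_pos ⟨hc, hv⟩] at h12
    obtain ⟨f, hf⟩ := Finset.card_pos.1 (show 0 < F2.card by omega)
    have := hbal2 {f} (by simpa using hf) (by
      intro h; rw [← h] at h3; simp at h3)
    have hv : vcount {f} = k := by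
      rw [vcount, vset_single]; exact hu2 f hf
    rw [← mk_eq hbal2, dk, if_neg (by simp), if_pos ⟨by simp, hv⟩] at this
    linarith

theorem eps_exists (θ : ℝ) (K : ℕ) : ∃ ε : ℝ, 0 < ε ∧ ∀ a b : ℕ, a ≤ K → b ≤ K →
    (a : ℝ) < θ * b → (a : ℝ) + ε ≤ θ * b := by
  have hs : ∀ S : Finset (ℕ × ℕ), ∃ ε : ℝ, 0 < ε ∧ ∀ x ∈ S,
      (x.1 : ℝ) < θ * x.2 → (x.1 : ℝ) + ε ≤ θ * x.2 := by
    intro S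
    induction S using Finset.induction_on with
    | empty => exact ⟨1, one_pos, by simp⟩
    | insert x S _ ih =>
      obtain ⟨ε, h0, h⟩ := ih
      by_cases hx : (x.1 : ℝ) < θ * x.2
      · refine ⟨min ε (θ * x.2 - x.1), lt_min h0 (by linarith), ?_⟩
        intro y hy hy2
        rcases Finset.mem_insert.1 hy with rfl | hy
        · have := min_le_right ε (θ * y.2 - y.1); linarith
        · have := min_le_left ε (θ * x.2 - x.1)
          have := h y hy hy2; linarith
      · refine ⟨ε, h0, ?_⟩
        intro y hy hy2
        rcases Finset.mem_insert.1 hy with rfl | hy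
        · exact absurd hy2 hx
        · exact h y hy hy2
  obtain ⟨ε, h0, h⟩ := hs (Finset.range (K + 1) ×ˢ Finset.range (K + 1))
  exact ⟨ε, h0, fun a b ha hb => h (a, b) (by simp; omega)⟩

theorem card_sdiff_inter (A G : Finset (Finset ℕ)) :
    ((A \ G).card : ℝ) = (A.card : ℝ) - ((A ∩ G).card : ℝ) := by
  have := Finset.card_sdiff_add_card_inter A G
  rw [← this]; push_cast; ring

theorem new_le (A G : Finset (Finset ℕ)) :
    ((vset A \ vset G).card : ℝ) ≤ (vcount A : ℝ) - vcount (A ∩ G) := by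
  have h1 : vset A \ vset G ⊆ vset A \ vset (A ∩ G) :=
    Finset.sdiff_subset_sdiff subset_rfl (vset_mono Finset.inter_subset_right)
  have h2 := Finset.card_le_card h1
  have h3 := Finset.card_sdiff_add_card_eq_card (vset_mono (Finset.inter_subset_left (s₁ := A) (s₂ := G)))
  rw [vcount, vcount, ← h3]; push_cast
  have : ((vset A \ vset G).card : ℝ) ≤ (vset A \ vset (A ∩ G)).card := by exact_mod_cast h2
  linarith

theorem f1_step {k : ℕ} {F1 F2 A G : Finset (Finset ℕ)} (hu1 : IsUniform k F1)
    (hm2 : 1 ≤ mk k F2) (hsb : StrictlyBalancedWrt k F1 F2) (hA : IsCopy F1 A)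
    (hn : (A ∩ G).Nonempty) (hAG : ¬ A ⊆ G) :
    ((vset A \ vset G).card : ℝ) < 1 / mkA k F1 F2 * ((A \ G).card : ℝ) := by
  have hF1 : F1.Nonempty := by
    rw [← Finset.card_pos, ← copy_card hA, Finset.card_pos]
    exact hn.mono Finset.inter_subset_left
  have hpos := mkA_pos hF1 hu1 hm2 hsb
  have h0 := new_le A G
  rw [card_sdiff_inter]
  obtain ⟨H0, hH0, h1, h2⟩ := copy_sub hA (Finset.inter_subset_left (s₁ := A) (s₂ := G))
  have hlt : (A ∩ G).card < A.card := Finset.card_lt_card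
    ⟨Finset.inter_subset_left, fun h => hAG (h.trans Finset.inter_subset_right)⟩
  have hH0n : H0.Nonempty := by rw [← Finset.card_pos, h1]; exact hn.card_pos
  have hs := hsb H0 hH0 hH0n (by
    rintro rfl
    rw [h1.symm, copy_card hA] at hlt
    exact lt_irrefl _ hlt)
  have he := mkA_eq hF1 hsb
  have hi : 0 < 1 / mk k F2 := by positivity
  have hv1 : (k : ℝ) ≤ vcount F1 := by exact_mod_cast vcount_ge hu1 hF1
  have hv2 : (k : ℝ) ≤ vcount H0 := by exact_mod_cast vcount_ge (uniform_sub hu1 hH0) hH0n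
  rw [div_lt_iff₀ (by linarith)] at hs
  rw [eq_div_iff (by linarith)] at he
  rw [copy_card hA, ← h1]
  rw [copy_vcount hA, ← h2] at h0
  refine h0.trans_lt ?_
  rw [one_div, lt_inv_mul_iff₀ hpos]
  nlinarith

theorem f2_step {k : ℕ} {F1 F2 B X G : Finset (Finset ℕ)} {e0 : Finset ℕ}
    {g : Finset ℕ → Finset (Finset ℕ)} (hu1 : IsUniform k F1)
    (hpos : 0 < mkA k F1 F2) (hab : AsymBalanced k F1 F2)
    (he0 : e0 ∈ B) (heG : e0 ∈ G) (hB : IsCopy F2 B)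
    (hg : ∀ e ∈ B.erase e0, IsCopy F1 (g e) ∧ e ∈ g e)
    (hX : X = B ∪ (B.erase e0).biUnion g) (hBG : ¬ B ⊆ G) :
    ((vset X \ vset G).card : ℝ) < 1 / mkA k F1 F2 * ((X \ G).card : ℝ) ∨
    (((vset X \ vset G).card : ℝ) = 1 / mkA k F1 F2 * ((X \ G).card : ℝ) ∧
      vset X ∩ vset G = e0 ∧ vcount X = vcount F2 + (F2.card - 1) * (vcount F1 - k)) := by
  have hXG : (X \ G).Nonempty := by
    rw [Finset.sdiff_nonempty]
    intro h; apply hBG; refine Finset.Subset.trans ?_ h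
    rw [hX]; exact Finset.subset_union_left
  have hb : (0 : ℝ) < (X \ G).card := by exact_mod_cast hXG.card_pos
  have h0 := new_le X G
  have heX : e0 ∈ X := by rw [hX]; exact Finset.mem_union_left _ he0
  have heH : e0 ∈ X ∩ G := Finset.mem_inter.2 ⟨heX, heG⟩
  have hsub : vset (X ∩ G) ⊆ vset X := vset_mono Finset.inter_subset_left
  by_cases hv : vset (X ∩ G) = vset X
  · left
    have : vcount (X ∩ G) = vcount X := by rw [vcount, hv, vcount]
    rw [this, sub_self] at h0
    refine h0.trans_lt ?_
    positivity
  · have hatt : IsAttachment F1 F2 X e0 := ⟨B, he0, hB, g, hg, hX⟩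
    have hss := hsub.ssubset_of_ne hv
    obtain ⟨h1, h2⟩ := hab X ⟨e0, hatt⟩ (X ∩ G) Finset.inter_subset_left hss ⟨e0, heH, hatt⟩
    have hvlt : (vcount (X ∩ G) : ℝ) < vcount X := by exact_mod_cast Finset.card_lt_card hss
    rw [← card_sdiff_inter] at h1 h2
    have h1' : (vcount X : ℝ) - vcount (X ∩ G) ≤ 1 / mkA k F1 F2 * ((X \ G).card : ℝ) := by
      rw [le_div_iff₀ (by linarith)] at h1
      rw [one_div, le_inv_mul_iff₀ hpos]; exact h1
    rcases lt_or_ge ((vset X \ vset G).card : ℝ) (1 / mkA k F1 F2 * ((X \ G).card : ℝ)) with h | h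
    · exact Or.inl h
    · right
      have e1 : ((vset X \ vset G).card : ℝ) = (vcount X : ℝ) - vcount (X ∩ G) := by linarith
      have e2 : (vcount X : ℝ) - vcount (X ∩ G) = 1 / mkA k F1 F2 * ((X \ G).card : ℝ) := by
        linarith
      obtain ⟨⟨e', _, hH⟩, hgen⟩ := h2 (by
        rw [e2]; field_simp)
      have : e' = e0 := by rw [hH] at heH; exact (Finset.mem_singleton.1 heH).symm
      subst this
      refine ⟨by linarith, ?_, gen_count hu1 hgen⟩
      have h3 : vset X \ vset G ⊆ vset X \ vset (X ∩ G) :=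
        Finset.sdiff_subset_sdiff subset_rfl (vset_mono Finset.inter_subset_right)
      have h4 : vset X \ vset G = vset X \ vset (X ∩ G) := by
        apply Finset.eq_of_subset_of_card_le h3
        have := Finset.card_sdiff_add_card_eq_card hsub
        have h5 : ((vset X \ vset (X ∩ G)).card : ℝ) = (vcount X : ℝ) - vcount (X ∩ G) := by
          rw [vcount, vcount, ← this]; push_cast; ring
        rw [← e1] at h5
        exact_mod_cast h5.le
      rw [hH, vset_single] at h4
      apply Finset.Subset.antisymm
      · intro x hx
        rw [Finset.mem_inter] at hx
        by_contra hxe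
        have : x ∈ vset X \ e' := Finset.mem_sdiff.2 ⟨hx.1, hxe⟩
        rw [← h4, Finset.mem_sdiff] at this
        exact this.2 hx.2
      · exact Finset.subset_inter (sub_vset heX) (sub_vset heG)

theorem star_card {F1 F2 B X : Finset (Finset ℕ)} {e0 : Finset ℕ}
    {g : Finset ℕ → Finset (Finset ℕ)} (hB : IsCopy F2 B)
    (hg : ∀ e ∈ B.erase e0, IsCopy F1 (g e) ∧ e ∈ g e)
    (hX : X = B ∪ (B.erase e0).biUnion g) :
    X.card ≤ F2.card + F2.card * F1.card ∧ vcount X ≤ vcount F2 + F2.card * vcount F1 := by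
  have hBc : (B.erase e0).card ≤ F2.card := by
    rw [← copy_card hB]; exact Finset.card_le_card (Finset.erase_subset _ _)
  constructor
  · rw [hX]
    refine (Finset.card_union_le _ _).trans ?_
    rw [copy_card hB]
    apply Nat.add_le_add_left
    refine (Finset.card_biUnion_le_card_mul _ _ F1.card ?_).trans (Nat.mul_le_mul_right _ hBc)
    intro e he
    exact (copy_card (hg e he).1).le
  · rw [vcount, vset_star hX]
    refine (Finset.card_union_le _ _).trans ?_
    have : (vset B).card = vcount F2 := copy_vcount hB
    rw [this]
    apply Nat.add_le_add_left
    refine (Finset.card_biUnion_le_card_mul _ _ (vcount F1) ?_).trans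
      (Nat.mul_le_mul_right _ hBc)
    intro e he
    rw [← copy_vcount (hg e he).1]
    exact Finset.card_le_card Finset.sdiff_subset

theorem extract {k n K D0 : ℕ} {ε : ℝ} {F1 F2 H G' : Finset (Finset ℕ)}
    (hu1 : IsUniform k F1) (hu2 : IsUniform k F2) (h2 : 2 ≤ F1.card)
    (h3 : 3 ≤ F2.card) (hm1 : 1 ≤ mk k F1) (hm2 : 1 ≤ mk k F2)
    (hb1 : StrictlyKBalanced k F1) (hb2 : StrictlyKBalanced k F2)
    (hsb : StrictlyBalancedWrt k F1 F2) (hab : AsymBalanced k F1 F2)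
    (hK : k + vcount F1 + vcount F2 + F1.card + F2.card + F2.card * vcount F1 +
      F2.card * F1.card ≤ K)
    (hε : ∀ a b : ℕ, a ≤ K → b ≤ K →
      (a : ℝ) < 1 / mkA k F1 F2 * b → (a : ℝ) + ε ≤ 1 / mkA k F1 F2 * b)
    (hH : H ⊆ allEdges k n) (hG' : IsMinimalCore F1 F2 H G')
    (hL : K * (1 + (K + 1) * D0) < vcount G') :
    ∀ s d (G D : Finset (Finset ℕ)) S, G ⊆ G' → G.Nonempty → D ⊆ G →
      (∀ A ⊆ hatH F1 F2 H, (IsCopy F1 A ∨ IsCopy F2 A) → (A ∩ D).Nonempty → A ⊆ G) →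
      PSys F1 G S → d ≤ D0 → vcount G ≤ K * (1 + S.card + (K + 1) * (D0 - d)) →
      Bad k n K (1 / mkA k F1 F2) ε H s d G D := by
  obtain ⟨-, hcore, hmin⟩ := hG'
  have hF1 : F1.Nonempty := Finset.card_pos.1 (by omega)
  have hpos := mkA_pos hF1 hu1 hm2 hsb
  have hG'H : G' ⊆ H := hcore.1.trans (hatH_sub _ _ _)
  intro s
  induction s with
  | zero =>
    intro d G D S hG _ _ _ _ _ _
    simp only [Bad]
    exact hG.trans hG'H
  | succ s ih =>
    intro d G D S hG hGn hDG hdone hS hd hv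
    cases d with
    | zero =>
      simp only [Bad]
      exact hG.trans hG'H
    | succ d =>
      simp only [Bad]
      have hne : (G \ D).Nonempty := by
        by_contra hcon
        rw [Finset.sdiff_nonempty, not_not] at hcon
        have hGD : D = G := Finset.Subset.antisymm hDG hcon
        subst hGD
        have hGc : IsCore F1 F2 H D := by
          refine ⟨hG.trans hcore.1, fun A hA hc => ?_⟩
          by_cases hAD : (A ∩ D).Nonempty
          · exact Or.inl (hdone A hA hc hAD)
          · exact Or.inr (Finset.not_nonempty_iff_eq_empty.1 hAD)
        have hGG : D = G' := by
          by_contra hne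
          exact hmin D hG hGn hne hGc
        have hS0 : S = ∅ := by
          rw [Finset.eq_empty_iff_forall_notMem]
          intro P hP
          exact no_pend hu1 hu2 h2 h3 hm1 hm2 hb1 hb2 (core_closed hGc) (hS.1 P hP)
        rw [hS0, hGG, Finset.card_empty] at hv
        have : K * (1 + 0 + (K + 1) * (D0 - (d + 1))) ≤ K * (1 + (K + 1) * D0) := by
          apply Nat.mul_le_mul_left
          rw [add_zero]
          apply Nat.add_le_add_left
          apply Nat.mul_le_mul_left
          omega
        omega
      have hp := pick_mem hne
      generalize hee : pick G D = e at hp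
      have heG := (Finset.mem_sdiff.1 hp).1
      have hvU : ∀ X, vcount X ≤ K → vcount (G ∪ X) ≤ vcount G + K := by
        intro X hX
        have : vcount (G ∪ X) ≤ vcount G + vcount X := by
          rw [vcount, vset_union]; exact Finset.card_union_le _ _
        omega
      have hdone' : ∀ X, ∀ A ⊆ hatH F1 F2 H, (IsCopy F1 A ∨ IsCopy F2 A) → (A ∩ D).Nonempty →
          A ⊆ G ∪ X := fun X A hA hc hAD => (hdone A hA hc hAD).trans Finset.subset_union_left
      have deg : ∀ X ⊆ G', vcount X ≤ K → X.card ≤ K → ¬ X ⊆ G →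
          ((vset X \ vset G).card : ℝ) < 1 / mkA k F1 F2 * ((X \ G).card : ℝ) →
          ∃ X ∈ DgSet k n K (1 / mkA k F1 F2) ε G,
            Bad k n K (1 / mkA k F1 F2) ε H s d (G ∪ X) D := by
        intro X hX hvX hcX hXG hlt
        refine ⟨X, ?_, ?_⟩
        · simp only [DgSet, Finset.mem_filter, Finset.mem_powerset]
          refine ⟨hX.trans (hG'H.trans hH), hvX, Finset.sdiff_nonempty.2 hXG, hε _ _ ?_ ?_ hlt⟩
          · exact (Finset.card_le_card Finset.sdiff_subset).trans hvX
          · exact (Finset.card_le_card Finset.sdiff_subset).trans hcX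
        · obtain ⟨S', hS', hSc⟩ := psys_deg hS X
          apply ih d (G ∪ X) D S' (Finset.union_subset hG hX) (hGn.mono Finset.subset_union_left)
            (hDG.trans Finset.subset_union_left) (hdone' X) hS' (by omega)
          refine (hvU X hvX).trans ?_
          calc vcount G + K ≤ K * (1 + S.card + (K + 1) * (D0 - (d + 1))) + K :=
                Nat.add_le_add_right hv K
            _ = K * (1 + S.card + (K + 1) * (D0 - (d + 1)) + 1) := by ring
            _ ≤ _ := by
                apply Nat.mul_le_mul_left
                have : D0 - d = D0 - (d + 1) + 1 := by omega
                rw [this, mul_add]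
                omega
      have hcase : ∀ e' ∈ G', ∃ A ⊆ G', IsCopy F1 A ∧ e' ∈ A := by
        intro e' he'
        obtain ⟨A, hA, B, hB, hcA, hcB, hAB⟩ := core_closed hcore e' he'
        have hm : e' ∈ A ∩ B := by rw [hAB]; simp
        exact ⟨A, hA, hcA, (Finset.mem_inter.1 hm).1⟩
      by_cases hc1 : ∃ A ⊆ hatH F1 F2 H, IsCopy F1 A ∧ e ∈ A ∧ ¬ A ⊆ G
      · obtain ⟨A, hA, hcA, heA, hAG⟩ := hc1
        right; right
        have hAG' := core_absorb hcore hA (Or.inl hcA) heA (hG heG)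
        refine deg A hAG' ?_ ?_ hAG (f1_step hu1 hm2 hsb hcA
          ⟨e, Finset.mem_inter.2 ⟨heA, heG⟩⟩ hAG)
        · rw [copy_vcount hcA]; omega
        · rw [copy_card hcA]; omega
      by_cases hc2 : ∃ B ⊆ hatH F1 F2 H, IsCopy F2 B ∧ e ∈ B ∧ ¬ B ⊆ G
      · obtain ⟨B, hB, hcB, heB, hBG⟩ := hc2
        right
        have hBG' := core_absorb hcore hB (Or.inr hcB) heB (hG heG)
        choose! g hg using hcase
        set X := B ∪ (B.erase e).biUnion g with hX
        have hg' : ∀ e' ∈ B.erase e, IsCopy F1 (g e') ∧ e' ∈ g e' := fun e' he' =>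
          (hg e' (hBG' (Finset.mem_of_mem_erase he'))).2
        have hXG' : X ⊆ G' := by
          apply Finset.union_subset hBG'
          rw [Finset.biUnion_subset]
          exact fun e' he' => (hg e' (hBG' (Finset.mem_of_mem_erase he'))).1
        obtain ⟨hXc, hXv⟩ := star_card hcB hg' hX
        have hXG : ¬ X ⊆ G := fun h => hBG (Finset.subset_union_left.trans h)
        rcases f2_step hu1 hpos hab heB heG hcB hg' hX hBG with h | ⟨h, hi, hcnt⟩
        · right
          exact deg X hXG' (by omega) (by omega) hXG h
        · left
          refine ⟨X, ?_, ?_⟩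
          · simp only [NdSet, Finset.mem_filter, Finset.mem_powerset]
            exact ⟨hXG'.trans (hG'H.trans hH), by omega, hi,
              Finset.sdiff_nonempty.2 hXG, h.le⟩
          · obtain ⟨S', hS', hSc⟩ := psys_nondeg hu1 h2 h3 hS heB hcB hg' hX hcnt heG hi
            apply ih (d + 1) (G ∪ X) D S' (Finset.union_subset hG hXG')
              (hGn.mono Finset.subset_union_left)
              (hDG.trans Finset.subset_union_left) (hdone' X) hS' hd
            refine (hvU X (by omega)).trans ?_
            calc vcount G + K ≤ K * (1 + S.card + (K + 1) * (D0 - (d + 1))) + K :=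
                  Nat.add_le_add_right hv K
              _ = K * (1 + S.card + (K + 1) * (D0 - (d + 1)) + 1) := by ring
              _ ≤ _ := by
                  apply Nat.mul_le_mul_left
                  omega
      · left
        refine ⟨hp, ih (d + 1) G (insert e D) S hG hGn (Finset.insert_subset heG hDG) ?_ hS hd hv⟩
        intro A hA hc hAD
        by_cases heA : e ∈ A
        · by_contra hAG
          rcases hc with hc | hc
          · exact hc1 ⟨A, hA, hc, heA, hAG⟩
          · exact hc2 ⟨A, hA, hc, heA, hAG⟩
        · apply hdone A hA hc
          obtain ⟨x, hx⟩ := hAD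
          rw [Finset.mem_inter, Finset.mem_insert] at hx
          rcases hx.2 with rfl | hxD
          · exact absurd hx.1 heA
          · exact ⟨x, Finset.mem_inter.2 ⟨hx.1, hxD⟩⟩

theorem lim2 {C ε : ℝ} {k D0 : ℕ} (h : (k : ℝ) < D0 * ε) :
    Filter.Tendsto (fun n : ℕ => (n : ℝ) ^ k * (C * (n : ℝ) ^ (-ε)) ^ D0) Filter.atTop
      (nhds 0) := by
  have h1 := ((tendsto_rpow_neg_atTop (y := D0 * ε - k) (by linarith)).comp
    (tendsto_natCast_atTop_atTop (R := ℝ))).const_mul (C ^ D0)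
  rw [mul_zero] at h1
  refine h1.congr' ?_
  filter_upwards [Filter.eventually_ge_atTop 1] with n hn
  have hn0 : (0 : ℝ) < n := by exact_mod_cast hn
  simp only [Function.comp]
  rw [mul_pow, ← Real.rpow_natCast ((n : ℝ) ^ (-ε)), ← Real.rpow_mul hn0.le,
    show -(D0 * ε - k) = (k : ℝ) + -ε * D0 by ring, Real.rpow_add hn0, Real.rpow_natCast]
  ring

theorem lim1 {τ : ℝ} (hτ : 0 < τ) (k : ℕ) :
    Filter.Tendsto (fun n : ℕ => (n : ℝ) ^ k * (3 / 4) ^ ⌊(n : ℝ) ^ τ⌋₊) Filter.atTop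
      (nhds 0) := by
  have hb : 0 < -Real.log (3 / 4) := by
    have := Real.log_neg (x := 3 / 4) (by norm_num) (by norm_num)
    linarith
  have h1 := (((tendsto_rpow_mul_exp_neg_mul_atTop_nhds_zero (k / τ) _ hb).comp
    (tendsto_rpow_atTop hτ)).comp (tendsto_natCast_atTop_atTop (R := ℝ))).const_mul (4 / 3)
  rw [mul_zero] at h1
  refine squeeze_zero' (Filter.Eventually.of_forall fun n => by positivity) ?_ h1
  filter_upwards [Filter.eventually_ge_atTop 1] with n hn
  have hn0 : (0 : ℝ) < n := by exact_mod_cast hn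
  simp only [Function.comp]
  rw [← Real.rpow_mul hn0.le, mul_div_cancel₀ _ hτ.ne', Real.rpow_natCast]
  have h2 : ((3 : ℝ) / 4) ^ ⌊(n : ℝ) ^ τ⌋₊ ≤
      4 / 3 * Real.exp (-(-Real.log (3 / 4)) * (n : ℝ) ^ τ) := by
    rw [neg_neg, ← Real.rpow_def_of_pos (by norm_num), ← Real.rpow_natCast]
    calc ((3 : ℝ) / 4) ^ ((⌊(n : ℝ) ^ τ⌋₊ : ℕ) : ℝ) ≤ (3 / 4) ^ ((n : ℝ) ^ τ - 1) := by
          apply Real.rpow_le_rpow_of_exponent_ge (by norm_num) (by norm_num)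
          have := Nat.lt_floor_add_one ((n : ℝ) ^ τ)
          linarith
      _ = _ := by
          rw [Real.rpow_sub_one (by norm_num)]; ring
  calc _ ≤ (n : ℝ) ^ k * (4 / 3 * Real.exp (-(-Real.log (3 / 4)) * (n : ℝ) ^ τ)) := by gcongr
    _ = _ := by ring

/-- for `p ≤ c·n^{-1/m_k(F₁,F₂)}`, a.a.s. every minimal closed `(F₁,F₂)`-core
of `H^k(n,p)` has at most `L` vertices. -/
theorem bounded_core (k : ℕ) (hk : 1 ≤ k) (F1 F2 : Finset (Finset ℕ))
    (hu1 : IsUniform k F1) (hu2 : IsUniform k F2)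
    (h3 : 3 ≤ F2.card)
    (h12 : mk k F2 ≤ mk k F1) (hge1 : 1 ≤ mk k F2)
    (hbal1 : StrictlyKBalanced k F1) (hbal2 : StrictlyKBalanced k F2)
    (hsb : StrictlyBalancedWrt k F1 F2)
    (hab : AsymBalanced k F1 F2) :
    ∃ c : ℝ, 0 < c ∧ ∃ L : ℕ, 0 < L ∧ ∀ p : ℕ → ℝ,
      (∀ n : ℕ, 0 ≤ p n ∧ p n ≤ c * (n : ℝ) ^ (-(1 / mkA k F1 F2))) →
      Filter.Tendsto (fun n : ℕ => prob k n (p n)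
          (fun H => ∀ G' : Finset (Finset ℕ), IsMinimalCore F1 F2 H G' → vcount G' ≤ L))
        Filter.atTop (nhds 1) := by
  have h2 : 2 ≤ F1.card := f1_card hu1 hu2 h3 h12 hge1 hbal1 hbal2
  have hF1 : F1.Nonempty := Finset.card_pos.1 (by omega)
  obtain ⟨K, hK⟩ : ∃ K, K = k + vcount F1 + vcount F2 + F1.card + F2.card +
    F2.card * vcount F1 + F2.card * F1.card := ⟨_, rfl⟩
  have hkK : k ≤ K := by rw [hK]; simp only [add_assoc]; exact Nat.le_add_right _ _
  have hK1 : 1 ≤ K := hk.trans hkK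
  have hpos := mkA_pos hF1 hu1 hge1 hsb
  obtain ⟨ε, hε0, hε⟩ := eps_exists (1 / mkA k F1 F2) K
  obtain ⟨D0, hD0⟩ := exists_nat_gt (2 * k / ε)
  have hD0' : (k : ℝ) < D0 * (ε / 2) := by
    rw [div_lt_iff₀ hε0] at hD0; linarith
  have hQ : (1 : ℝ) ≤ (K + 1) * 2 ^ 2 ^ K := by
    have h1 : (1 : ℝ) ≤ 2 ^ 2 ^ K := one_le_pow₀ (by norm_num)
    have h2 : (1 : ℝ) ≤ K + 1 := by have : (0 : ℝ) ≤ K := by positivity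
                                    linarith
    nlinarith
  obtain ⟨c, hcdef⟩ : ∃ c : ℝ, c = 1 / (16 * ((K + 1) * 2 ^ 2 ^ K)) := ⟨_, rfl⟩
  have hc0 : 0 < c := by rw [hcdef]; positivity
  have hc : 2 * c * ((K + 1) * 2 ^ 2 ^ K) ≤ 1 / 8 := by
    apply le_of_eq; rw [hcdef]; field_simp; norm_num
  have hc1 : 2 * c ≤ 1 := by nlinarith
  refine ⟨c, hc0, K * (1 + (K + 1) * D0), by positivity, ?_⟩
  intro p hp
  have hτ : 0 < ε / (2 * K) := by positivity
  obtain ⟨C, hC⟩ : ∃ C : ℝ, C = (K + 1) * (3 * K) ^ K := ⟨_, rfl⟩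
  have hC0 : 0 ≤ C := by rw [hC]; positivity
  have hθ : 0 ≤ 1 / mkA k F1 F2 := by positivity
  have lim := ((lim1 hτ k).add (lim2 (C := C) hD0')).const_mul 2
  rw [add_zero, mul_zero] at lim
  have lim0 := ((tendsto_rpow_neg_atTop (y := ε / 2) (by positivity)).comp
    (tendsto_natCast_atTop_atTop (R := ℝ))).const_mul C
  rw [mul_zero] at lim0
  have hlow : ∀ᶠ n : ℕ in Filter.atTop, 1 - 2 * ((n : ℝ) ^ k * (3 / 4) ^ ⌊(n : ℝ) ^ (ε / (2 * K))⌋₊ +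
      (n : ℝ) ^ k * (C * (n : ℝ) ^ (-(ε / 2))) ^ D0) ≤ prob k n (p n)
          (fun H => ∀ G' : Finset (Finset ℕ), IsMinimalCore F1 F2 H G' →
            vcount G' ≤ K * (1 + (K + 1) * D0)) ∧ prob k n (p n)
          (fun H => ∀ G' : Finset (Finset ℕ), IsMinimalCore F1 F2 H G' →
            vcount G' ≤ K * (1 + (K + 1) * D0)) ≤ 1 := by
    filter_upwards [Filter.eventually_ge_atTop 1, lim0.eventually_le_const zero_lt_one]
      with n hn hsmall
    simp only [Function.comp] at hsmall
    obtain ⟨hp0, hpn⟩ := hp n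
    have hn' : (1 : ℝ) ≤ n := by exact_mod_cast hn
    have hp1 : p n ≤ 1 := by
      have : (n : ℝ) ^ (-(1 / mkA k F1 F2)) ≤ 1 :=
        Real.rpow_le_one_of_one_le_of_nonpos hn' (by linarith)
      nlinarith
    have htot := prob_true k n (p n) (fun H => ∀ G' : Finset (Finset ℕ),
      IsMinimalCore F1 F2 H G' → vcount G' ≤ K * (1 + (K + 1) * D0))
    have hnn := prob_nonneg (k := k) (n := n) hp0 hp1 (fun H => ¬ ∀ G' : Finset (Finset ℕ),
      IsMinimalCore F1 F2 H G' → vcount G' ≤ K * (1 + (K + 1) * D0))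
    obtain ⟨T, hT⟩ : ∃ T, T = ⌊(n : ℝ) ^ (ε / (2 * K))⌋₊ := ⟨_, rfl⟩
    obtain ⟨M, hM⟩ : ∃ M, M = K * (T + 1) := ⟨_, rfl⟩
    obtain ⟨η, hη⟩ : ∃ η : ℝ, η = 1 / 8 * ((K + 1) * (M + 1) ^ K * (n : ℝ) ^ (-ε)) := ⟨_, rfl⟩
    have hη0 : 0 ≤ η := by rw [hη]; positivity
    have h8 : 8 * η ≤ C * (n : ℝ) ^ (-(ε / 2)) := by
      have hx : (1 : ℝ) ≤ (n : ℝ) ^ (ε / (2 * K)) := Real.one_le_rpow hn' hτ.le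
      have hTx : (T : ℝ) ≤ (n : ℝ) ^ (ε / (2 * K)) := by
        rw [hT]; exact Nat.floor_le (by positivity)
      have hKr : (1 : ℝ) ≤ K := by exact_mod_cast hK1
      have hMx : (M : ℝ) + 1 ≤ 3 * K * (n : ℝ) ^ (ε / (2 * K)) := by
        rw [hM]; push_cast; nlinarith
      have hpow : ((M : ℝ) + 1) ^ K ≤ (3 * K) ^ K * (n : ℝ) ^ (ε / 2) := by
        calc ((M : ℝ) + 1) ^ K ≤ (3 * K * (n : ℝ) ^ (ε / (2 * K))) ^ K := by gcongr
          _ = _ := by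
            rw [mul_pow, ← Real.rpow_natCast ((n : ℝ) ^ (ε / (2 * K))), ← Real.rpow_mul
              (by positivity)]
            congr 2; field_simp
      have hsplit : (n : ℝ) ^ (ε / 2) * (n : ℝ) ^ (-ε) = (n : ℝ) ^ (-(ε / 2)) := by
        rw [← Real.rpow_add (by linarith)]; congr 1; ring
      rw [hη, hC, ← hsplit]
      calc 8 * (1 / 8 * ((K + 1) * ((M : ℝ) + 1) ^ K * (n : ℝ) ^ (-ε)))
          = (K + 1) * ((M : ℝ) + 1) ^ K * (n : ℝ) ^ (-ε) := by ring
        _ ≤ (K + 1) * ((3 * K) ^ K * (n : ℝ) ^ (ε / 2)) * (n : ℝ) ^ (-ε) := by gcongr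
        _ = _ := by ring
    have hηs : η ≤ 1 / 8 := by linarith
    have hbb := bad_bound (k := k) (n := n) (K := K) (M := M) (θ := 1 / mkA k F1 F2) (ε := ε)
      hp0 hp1 hη0 hηs (nd_bound hn hc0 hc hc1 hp0 hpn)
      (fun G hG => (dg_bound hn hc0 hc hc1 hp0 hpn G hG).trans_eq hη.symm)
    have hup : prob k n (p n) (fun H => ¬ ∀ G' : Finset (Finset ℕ),
        IsMinimalCore F1 F2 H G' → vcount G' ≤ K * (1 + (K + 1) * D0)) ≤
        2 * ((n : ℝ) ^ k * (3 / 4) ^ T + (n : ℝ) ^ k * (C * (n : ℝ) ^ (-(ε / 2))) ^ D0) := by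
      refine (prob_mono hp0 hp1 (Q := fun H => ∃ e ∈ allEdges k n,
        Bad k n K (1 / mkA k F1 F2) ε H T D0 {e} ∅) ?_).trans ?_
      · intro H hH hnot
        push Not at hnot
        obtain ⟨G', hG', hL⟩ := hnot
        obtain ⟨e, he⟩ := hG'.1
        have heA : e ∈ allEdges k n := hH (hatH_sub _ _ _ (hG'.2.1.1 he))
        refine ⟨e, heA, ?_⟩
        apply extract hu1 hu2 h2 h3 (hge1.trans h12) hge1 hbal1 hbal2 hsb hab hK.ge hε hH hG' hL
          T D0 {e} ∅ ∅ (by simpa using he) (by simp) (by simp)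
        · intro A _ _ hA; simp at hA
        · exact ⟨by simp, by simp⟩
        · exact le_rfl
        · rw [vcount, vset_single, (Finset.mem_powersetCard.1 heA).2]
          simpa using hkK
      · refine (prob_ex hp0 hp1 _ _).trans ?_
        calc _ ≤ ∑ _e ∈ allEdges k n,
              2 * ((3 / 4) ^ T + (C * (n : ℝ) ^ (-(ε / 2))) ^ D0) := by
              apply Finset.sum_le_sum
              intro e he
              refine (hbb T D0 {e} ∅ ?_).trans ?_
              · rw [vcount, vset_single, (Finset.mem_powersetCard.1 he).2, hM, mul_add, mul_one]
                omega
              · have hle : (8 * η) ^ D0 ≤ (C * (n : ℝ) ^ (-(ε / 2))) ^ D0 :=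
                  pow_le_pow_left₀ (by linarith) h8 _
                have h34 : (0 : ℝ) ≤ (3 / 4) ^ T := by positivity
                have h8n : 0 ≤ (8 * η) ^ D0 := by positivity
                simp only [Finset.card_singleton, pow_one, Finset.sdiff_empty]
                nlinarith
          _ = (allEdges k n).card * (2 * ((3 / 4) ^ T + (C * (n : ℝ) ^ (-(ε / 2))) ^ D0)) := by
              rw [Finset.sum_const, nsmul_eq_mul]
          _ ≤ (n : ℝ) ^ k * (2 * ((3 / 4) ^ T + (C * (n : ℝ) ^ (-(ε / 2))) ^ D0)) := by
              apply mul_le_mul_of_nonneg_right _ (by positivity)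
              rw [allEdges, Finset.card_powersetCard, Finset.card_range]
              exact_mod_cast Nat.choose_le_pow n k
          _ = _ := by ring
    rw [← hT]
    constructor <;> linarith
  have limlow := lim.const_sub 1
  rw [sub_zero] at limlow
  exact tendsto_of_tendsto_of_tendsto_of_le_of_le' limlow tendsto_const_nhds
    (hlow.mono fun n h => h.1) (hlow.mono fun n h => h.2)


end ARR
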